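/- There exists a positive integer ℓ₀ such that for every ℓ ≥ ℓ₀ and every n, every ℓ-cross-intersecting pair (𝒜, ℬ) of families of subsets of [n] satisfies |𝒜|·|ℬ| ≤ binom(2ℓ, ℓ)·2^(n−2ℓ). -/

import Mathlib

namespace CrossIntersecting
open Finset

theorem sum_lt_sum_of_subset_of_ne {I : Type*} {f : I → ℝ} {S T : Finset I} (h : S ⊆ T) (hne : S ≠ T)
    (hf : ∀ i ∈ T, 0 < f i) : ∑ i ∈ S, f i < ∑ i ∈ T, f i := by
  obtain ⟨x, hx, hx'⟩ := exists_of_ssubset (ssubset_of_subset_of_ne h hne)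
  exact sum_lt_sum_of_subset h hx hx' (hf x hx) fun i hi _ => (hf i hi).le

section Chains
variable {I : Type*} [DecidableEq I]

/-- Symmetric chain decomposition of the power set of `G`: `b T` is the bottom of the chain
through `T`. -/
theorem exists_symmetric_chains (G : Finset I) :
    ∃ b : Finset I → Finset I,
      (∀ T ⊆ G, b T ⊆ G ∧ #(b T) ≤ #T ∧ #T + #(b T) ≤ #G) ∧
      (∀ T ⊆ G, ∀ T' ⊆ G, b T = b T' → T ⊆ T' ∨ T' ⊆ T) ∧
      (∀ T ⊆ G, ∀ v, #(b T) ≤ v → v + #(b T) ≤ #G → ∃ T' ⊆ G, #T' = v ∧ b T' = b T) := by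
  induction G using Finset.induction_on with
  | empty =>
    refine ⟨fun _ => ∅, ?_, ?_, ?_⟩
    · intro T hT; simp [subset_empty.1 hT]
    · intro T hT T' _ _; left; simp [subset_empty.1 hT]
    · intro T hT v _ h2
      refine ⟨∅, by simp, ?_, rfl⟩
      simp at h2 ⊢; omega
  | insert a G ha ih =>
    obtain ⟨b, h1, h2, h3⟩ := ih
    have hcard : #(insert a G) = #G + 1 := card_insert_of_notMem ha
    let b' : Finset I → Finset I := fun T =>
      if a ∈ T then (if #(T.erase a) + #(b (T.erase a)) = #G then b (T.erase a)
        else insert a (b (T.erase a))) else b T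
    have hsub : ∀ T ⊆ insert a G, T.erase a ⊆ G := fun T hT => by
      intro x hx
      have := hT (mem_of_mem_erase hx)
      exact (mem_insert.1 this).resolve_left (ne_of_mem_erase hx)
    have hsub' : ∀ T ⊆ insert a G, a ∉ T → T ⊆ G := fun T hT h => by
      intro x hx
      exact (mem_insert.1 (hT hx)).resolve_left (fun h' => h (h' ▸ hx))
    have hab : ∀ T ⊆ G, a ∉ b T := fun T hT h => ha ((h1 T hT).1 h)
    have hT1 : ∀ T, a ∈ T → #T = #(T.erase a) + 1 := fun T h => (card_erase_add_one h).symm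
    have hmono : ∀ T : Finset I, a ∈ T → ∀ T' : Finset I, a ∈ T' → T.erase a ⊆ T'.erase a → T ⊆ T' := by
      intro T hT T' hT' h
      rw [← insert_erase hT, ← insert_erase hT']
      exact insert_subset_insert a h
    have key : ∀ T ⊆ insert a G, ∀ T' ⊆ insert a G, a ∉ T → a ∈ T' → b' T = b' T' → T ⊆ T' := by
      intro T hT T' hT' haT haT' h
      simp only [b', haT, haT', if_true, if_false] at h
      have hTG := hsub' T hT haT
      have hTG' := hsub T' hT'
      split_ifs at h with hc
      · refine Subset.trans ?_ (erase_subset a T')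
        rcases h2 T hTG _ hTG' h with h5 | h5
        · exact h5
        · have := (h1 T hTG).2.2
          rw [h] at this
          exact (eq_of_subset_of_card_le h5 (by omega)).symm.subset
      · exact absurd (h ▸ mem_insert_self a _) (hab T hTG)
    refine ⟨b', ?_, ?_, ?_⟩
    · intro T hT
      by_cases haT : a ∈ T
      · have hh := h1 _ (hsub T hT)
        have := hT1 T haT
        simp only [b', haT, if_true]
        split_ifs with hc
        · exact ⟨hh.1.trans (subset_insert a G), by omega, by omega⟩
        · rw [card_insert_of_notMem (hab _ (hsub T hT))]
          exact ⟨insert_subset_insert a hh.1, by omega, by omega⟩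
      · have hh := h1 _ (hsub' T hT haT)
        simp only [b', haT, if_false]
        exact ⟨hh.1.trans (subset_insert a G), hh.2.1, by omega⟩
    · intro T hT T' hT' h
      by_cases haT : a ∈ T <;> by_cases haT' : a ∈ T'
      · have hTG := hsub T hT
        have hTG' := hsub T' hT'
        have : b (T.erase a) = b (T'.erase a) := by
          simp only [b', haT, haT', if_true] at h
          have n1 := hab _ hTG
          have n2 := hab _ hTG'
          split_ifs at h
          · exact h
          · exact absurd (h ▸ mem_insert_self a _) n1
          · exact absurd (h ▸ mem_insert_self a _) n2
          · rw [← erase_insert n1, h, erase_insert n2]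
        rcases h2 _ hTG _ hTG' this with h5 | h5
        · exact Or.inl (hmono T haT T' haT' h5)
        · exact Or.inr (hmono T' haT' T haT h5)
      · exact Or.inr (key T' hT' T hT haT' haT h.symm)
      · exact Or.inl (key T hT T' hT' haT haT' h)
      · simp only [b', haT, haT', if_false] at h
        exact h2 T (hsub' T hT haT) T' (hsub' T' hT' haT') h
    · have lift : ∀ T ⊆ G, ∀ v, #(b T) ≤ v → v + #(b T) ≤ #G + 1 →
          ∃ T' ⊆ insert a G, #T' = v ∧ b' T' = b T := by
        intro T hT v hv hv'
        by_cases hlt : v + #(b T) ≤ #G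
        · obtain ⟨T', hT', hc, hb⟩ := h3 T hT v hv hlt
          have haT' : a ∉ T' := fun h => ha (hT' h)
          exact ⟨T', hT'.trans (subset_insert a G), hc, by simp only [b', haT', if_false, hb]⟩
        · have := (h1 T hT).2
          obtain ⟨T', hT', hc, hb⟩ := h3 T hT (#G - #(b T)) (by omega) (by omega)
          have haT' : a ∉ T' := fun h => ha (hT' h)
          refine ⟨insert a T', insert_subset_insert a hT', ?_, ?_⟩
          · rw [card_insert_of_notMem haT']; omega
          · simp only [b', mem_insert_self, if_true, erase_insert haT']
            rw [if_pos (by rw [hb]; omega), hb]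
      intro T hT v hv hv'
      rw [hcard] at hv'
      by_cases haT : a ∈ T
      · have hTG := hsub T hT
        by_cases hc : #(T.erase a) + #(b (T.erase a)) = #G
        · have hbT : b' T = b (T.erase a) := by simp only [b', haT, if_true, hc]
          rw [hbT] at hv hv' ⊢
          exact lift _ hTG v hv hv'
        · have hbT : b' T = insert a (b (T.erase a)) := by simp only [b', haT, if_true, hc, if_false]
          rw [hbT] at hv hv' ⊢
          rw [card_insert_of_notMem (hab _ hTG)] at hv hv'
          obtain ⟨T', hT', hc', hb⟩ := h3 _ hTG (v - 1) (by omega) (by omega)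
          have haT' : a ∉ T' := fun h => ha (hT' h)
          refine ⟨insert a T', insert_subset_insert a hT', ?_, ?_⟩
          · rw [card_insert_of_notMem haT']; omega
          · simp only [b', mem_insert_self, if_true, erase_insert haT', hb]
            rw [if_neg (by omega)]
      · have hTG := hsub' T hT haT
        have hbT : b' T = b T := by simp only [b', haT, if_false]
        rw [hbT] at hv hv' ⊢
        exact lift T hTG v hv hv'

/-- A map to the `v`-th layer whose fibres are chains. -/
theorem exists_chain_map (G : Finset I) (v : ℕ) :
    ∃ χ : Finset I → Finset I,
      (∀ T ⊆ G, (v = #G / 2 ∨ #G ≤ 2 * v ∧ v ≤ #T) → χ T ∈ powersetCard v G) ∧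
      (∀ T ⊆ G, ∀ T' ⊆ G, (v = #G / 2 ∨ #G ≤ 2 * v ∧ v ≤ #T) →
        (v = #G / 2 ∨ #G ≤ 2 * v ∧ v ≤ #T') → χ T = χ T' → T ⊆ T' ∨ T' ⊆ T) := by
  obtain ⟨b, h1, h2, h3⟩ := exists_symmetric_chains G
  have h4 : ∀ T, ∃ T', T ⊆ G → (v = #G / 2 ∨ #G ≤ 2 * v ∧ v ≤ #T) →
      T' ⊆ G ∧ #T' = v ∧ b T' = b T := by
    intro T
    by_cases hT : T ⊆ G
    · by_cases hv : v = #G / 2 ∨ #G ≤ 2 * v ∧ v ≤ #T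
      · have := h1 T hT
        obtain ⟨T', h⟩ := h3 T hT v (by omega) (by omega)
        exact ⟨T', fun _ _ => h⟩
      · exact ⟨∅, fun _ h => absurd h hv⟩
    · exact ⟨∅, fun h => absurd h hT⟩
  choose χ hχ using h4
  refine ⟨χ, fun T hT hv => ?_, fun T hT T' hT' hv hv' h => ?_⟩
  · exact mem_powersetCard.2 ⟨(hχ T hT hv).1, (hχ T hT hv).2.1⟩
  · exact h2 T hT T' hT' (by rw [← (hχ T hT hv).2.2, h, (hχ T' hT' hv').2.2])

theorem sum_symmDiff_neg (f f' : I → ℝ) (R T : Finset I) (hR : ∀ i ∈ R, f' i = -f i)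
    (hR' : ∀ i ∉ R, f' i = f i) :
    ∑ i ∈ symmDiff T R, f' i = ∑ i ∈ T, f i - ∑ i ∈ R, f i := by
  rw [symmDiff_def, sup_eq_union, sum_union disjoint_sdiff_sdiff]
  have e1 : ∑ i ∈ T \ R, f' i = ∑ i ∈ T \ R, f i :=
    sum_congr rfl fun i hi => hR' i (mem_sdiff.1 hi).2
  have e2 : ∑ i ∈ R \ T, f' i = -∑ i ∈ R \ T, f i := by
    rw [← sum_neg_distrib]
    exact sum_congr rfl fun i hi => hR i (mem_sdiff.1 hi).1
  have e3 := sum_inter_add_sum_sdiff T R f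
  have e4 := sum_inter_add_sum_sdiff R T f
  rw [inter_comm] at e4
  rw [e1, e2]; linarith

theorem card_two_sums_le_of_pos (G₁ G₂ : Finset I) (hd : Disjoint G₁ G₂) (β c : I → ℝ) (θ u v : ℝ)
    (hβ : ∀ i ∈ G₁ ∪ G₂, 0 < β i) (h₁ : ∀ i ∈ G₁, c i ≤ θ * β i) (h₂ : ∀ i ∈ G₂, θ * β i < c i)
    (F : Finset (Finset I)) (hF : ∀ T ∈ F, T ⊆ G₁ ∪ G₂)
    (hu : ∀ T ∈ F, ∑ i ∈ T, β i = u) (hv : ∀ T ∈ F, ∑ i ∈ T, c i = v) :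
    #F ≤ (#G₁).choose (#G₁ / 2) * (#G₂).choose (#G₂ / 2) := by
  obtain ⟨χ₁, m₁, i₁⟩ := exists_chain_map G₁ (#G₁ / 2)
  obtain ⟨χ₂, m₂, i₂⟩ := exists_chain_map G₂ (#G₂ / 2)
  have hsplit : ∀ T ∈ F, ∀ f : I → ℝ,
      ∑ i ∈ T, f i = ∑ i ∈ T ∩ G₁, f i + ∑ i ∈ T ∩ G₂, f i := by
    intro T hT f
    rw [← sum_union (hd.mono inter_subset_right inter_subset_right),
      ← inter_union_distrib_left, inter_eq_left.2 (hF T hT)]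
  rw [← card_powersetCard, ← card_powersetCard (#G₂ / 2) G₂, ← card_product]
  refine card_le_card_of_injOn (fun T => (χ₁ (T ∩ G₁), χ₂ (T ∩ G₂))) ?_ ?_
  · intro T hT
    exact mem_coe.2 (mem_product.2 ⟨m₁ _ inter_subset_right (Or.inl rfl),
      m₂ _ inter_subset_right (Or.inl rfl)⟩)
  · have key : ∀ T ∈ F, ∀ T' ∈ F, T ∩ G₁ ⊆ T' ∩ G₁ →
        (T ∩ G₂ ⊆ T' ∩ G₂ ∨ T' ∩ G₂ ⊆ T ∩ G₂) → T = T' := by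
      intro T hT T' hT' hs hs'
      have b1 := hsplit T hT β
      have b2 := hsplit T' hT' β
      have c1 := hsplit T hT fun i => c i - θ * β i
      have c2 := hsplit T' hT' fun i => c i - θ * β i
      have e : ∑ i ∈ T, (c i - θ * β i) = ∑ i ∈ T', (c i - θ * β i) := by
        rw [sum_sub_distrib, sum_sub_distrib, ← mul_sum, ← mul_sum, hu T hT, hu T' hT', hv T hT,
          hv T' hT']
      have b3 := (hu T hT).trans (hu T' hT').symm
      have p1 : ∑ i ∈ T ∩ G₁, β i ≤ ∑ i ∈ T' ∩ G₁, β i :=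
        sum_le_sum_of_subset_of_nonneg hs fun i hi _ =>
          (hβ i (mem_union_left _ (mem_inter.1 hi).2)).le
      have p2 : ∑ i ∈ T' ∩ G₁, (c i - θ * β i) ≤ ∑ i ∈ T ∩ G₁, (c i - θ * β i) := by
        rw [← neg_le_neg_iff, ← sum_neg_distrib, ← sum_neg_distrib]
        refine sum_le_sum_of_subset_of_nonneg hs fun i hi _ => ?_
        linarith [h₁ i (mem_inter.1 hi).2]
      have E2 : T ∩ G₂ = T' ∩ G₂ := by
        by_contra hne
        rcases hs' with hs' | hs'
        · have := sum_lt_sum_of_subset_of_ne (f := β) hs' hne fun i hi =>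
            hβ i (mem_union_right _ (mem_inter.1 hi).2)
          linarith
        · have := sum_lt_sum_of_subset_of_ne (f := fun i => c i - θ * β i) hs' (Ne.symm hne) fun i hi => by
            linarith [h₂ i (mem_inter.1 hi).2]
          linarith
      have E1 : T ∩ G₁ = T' ∩ G₁ := by
        by_contra hne
        have := sum_lt_sum_of_subset_of_ne (f := β) hs hne fun i hi =>
            hβ i (mem_union_left _ (mem_inter.1 hi).2)
        rw [E2] at b1
        linarith
      rw [← inter_eq_left.2 (hF T hT), ← inter_eq_left.2 (hF T' hT'), inter_union_distrib_left,
        inter_union_distrib_left, E1, E2]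
    intro T hT T' hT' h
    simp only [Prod.mk.injEq] at h
    have q1 := i₁ _ inter_subset_right _ inter_subset_right (Or.inl rfl) (Or.inl rfl) h.1
    have q2 := i₂ _ inter_subset_right _ inter_subset_right (Or.inl rfl) (Or.inl rfl) h.2
    rcases q1 with q1 | q1
    · exact key T hT T' hT' q1 q2
    · exact (key T' hT' T hT q1 q2.symm).symm

theorem symmDiff_filter_subset {G T : Finset I} (hT : T ⊆ G) (p : I → Prop) [DecidablePred p] :
    symmDiff T (G.filter p) ⊆ G := by
  rw [symmDiff_def, sup_eq_union]
  exact union_subset (sdiff_subset.trans hT) (sdiff_subset.trans (filter_subset _ _))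

/-- A planar Littlewood–Offord bound: vectors `(β i, c i)` of slope at most `θ` on `G₁` and of
slope larger than `θ` on `G₂`. -/
theorem card_two_sums_le (G₁ G₂ : Finset I) (hd : Disjoint G₁ G₂) (β c : I → ℝ) (θ u v : ℝ)
    (hβ : ∀ i ∈ G₁ ∪ G₂, β i ≠ 0) (h₁ : ∀ i ∈ G₁, c i / β i ≤ θ) (h₂ : ∀ i ∈ G₂, θ < c i / β i)
    (F : Finset (Finset I)) (hF : ∀ T ∈ F, T ⊆ G₁ ∪ G₂)
    (hu : ∀ T ∈ F, ∑ i ∈ T, β i = u) (hv : ∀ T ∈ F, ∑ i ∈ T, c i = v) :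
    #F ≤ (#G₁).choose (#G₁ / 2) * (#G₂).choose (#G₂ / 2) := by
  set R := (G₁ ∪ G₂).filter (fun i => β i < 0) with hR
  let β' : I → ℝ := fun i => if i ∈ R then -β i else β i
  let c' : I → ℝ := fun i => if i ∈ R then -c i else c i
  have hinj : Function.Injective fun T : Finset I => symmDiff T R :=
    fun T T' h => symmDiff_left_injective R h
  have hpos : ∀ i ∈ G₁ ∪ G₂, 0 < β' i := by
    intro i hi
    by_cases h : β i < 0
    · simp [β', hR, hi, h, -mem_union]
    · have : 0 < β i := lt_of_le_of_ne (not_lt.1 h) (hβ i hi).symm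
      simp [β', hR, h, this]
  have hratio : ∀ i, c' i / β' i = c i / β i := by
    intro i
    by_cases h : i ∈ R
    · simp [β', c', h, neg_div_neg_eq]
    · simp [β', c', h]
  rw [← card_image_of_injective F hinj]
  refine card_two_sums_le_of_pos G₁ G₂ hd β' c' θ (u - ∑ i ∈ R, β i) (v - ∑ i ∈ R, c i) hpos
    (fun i hi => ?_) (fun i hi => ?_) _ ?_ ?_ ?_
  · rw [← div_le_iff₀ (hpos i (mem_union_left _ hi)), hratio]; exact h₁ i hi
  · rw [← lt_div_iff₀ (hpos i (mem_union_right _ hi)), hratio]; exact h₂ i hi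
  all_goals
    intro T' hT'
    obtain ⟨T, hT, rfl⟩ := mem_image.1 hT'
  · exact symmDiff_filter_subset (hF T hT) _
  · rw [sum_symmDiff_neg β β' R T (fun i hi => by simp [β', hi]) (fun i hi => by simp [β', hi]),
      hu T hT]
  · rw [sum_symmDiff_neg c c' R T (fun i hi => by simp [c', hi]) (fun i hi => by simp [c', hi]),
      hv T hT]

/-- The Littlewood–Offord bound of Erdős. -/
theorem card_sum_eq_le (G : Finset I) (w : I → ℝ) (u : ℝ) (hw : ∀ i ∈ G, w i ≠ 0)
    (F : Finset (Finset I)) (hF : ∀ T ∈ F, T ⊆ G) (hu : ∀ T ∈ F, ∑ i ∈ T, w i = u) :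
    #F ≤ (#G).choose (#G / 2) := by
  simpa using card_two_sums_le G ∅ (disjoint_empty_right G) w (fun _ => 0) 0 u 0
    (by simpa using hw) (by simp) (by simp) F (by simpa using hF) hu (by simp)

/-- Subset sums with weights in `[-1, 1]` that hit a large value. -/
theorem card_sum_eq_le_choose (G : Finset I) (w : I → ℝ) (l : ℕ) (hw : ∀ i ∈ G, w i ≠ 0)
    (hw' : ∀ i ∈ G, |w i| ≤ 1) (hG : #G ≤ 2 * l)
    (F : Finset (Finset I)) (hF : ∀ T ∈ F, T ⊆ G) (hu : ∀ T ∈ F, ∑ i ∈ T, w i = l) :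
    #F ≤ (#G).choose l := by
  set R := G.filter (fun i => w i < 0) with hR
  let w' : I → ℝ := fun i => if i ∈ R then -w i else w i
  have hw'pos : ∀ i ∈ G, 0 < w' i ∧ w' i ≤ 1 := by
    intro i hi
    have h1 := abs_le.1 (hw' i hi)
    by_cases h : w i < 0
    · simp [w', hR, hi, h]; linarith
    · have : 0 < w i := lt_of_le_of_ne (not_lt.1 h) (hw i hi).symm
      simp [w', hR, h, this]; linarith
  have hsum : ∀ T ∈ F, ∑ i ∈ symmDiff T R, w' i = l - ∑ i ∈ R, w i := fun T hT => by
    rw [sum_symmDiff_neg w w' R T (fun i hi => by simp [w', hi]) (fun i hi => by simp [w', hi]),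
      hu T hT]
  have hsub : ∀ T ∈ F, symmDiff T R ⊆ G := fun T hT => symmDiff_filter_subset (hF T hT) _
  have hlarge : ∀ T ∈ F, l ≤ #(symmDiff T R) := by
    intro T hT
    have h1 : ∑ i ∈ symmDiff T R, w' i ≤ #(symmDiff T R) := by
      have := sum_le_card_nsmul (symmDiff T R) w' 1 fun i hi => (hw'pos i (hsub T hT hi)).2
      simpa using this
    have h2 : ∑ i ∈ R, w i ≤ 0 := sum_nonpos fun i hi => (mem_filter.1 hi).2.le
    rw [hsum T hT] at h1
    have : (l : ℝ) ≤ #(symmDiff T R) := by linarith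
    exact_mod_cast this
  obtain ⟨χ, m, inj⟩ := exists_chain_map G l
  rw [← card_powersetCard]
  refine card_le_card_of_injOn (fun T => χ (symmDiff T R)) ?_ ?_
  · intro T hT
    exact m _ (hsub T hT) (Or.inr ⟨hG, hlarge T hT⟩)
  · have key : ∀ T ∈ F, ∀ T' ∈ F, symmDiff T R ⊆ symmDiff T' R → T = T' := by
      intro T hT T' hT' h
      by_contra hne
      have := sum_lt_sum_of_subset_of_ne (f := w') h (fun h' => hne (symmDiff_left_injective R h'))
        fun i hi => (hw'pos i (hsub T' hT' hi)).1
      rw [hsum T hT, hsum T' hT'] at this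
      exact lt_irrefl _ this
    intro T hT T' hT' h
    rcases inj _ (hsub T hT) _ (hsub T' hT') (Or.inr ⟨hG, hlarge T hT⟩)
      (Or.inr ⟨hG, hlarge T' hT'⟩) h with h | h
    · exact key T hT T' hT' h
    · exact (key T' hT' T hT h).symm

end Chains

/-- The largest binomial coefficient of order `s`, normalised by `2 ^ s`. -/
noncomputable def midBinom (s : ℕ) : ℝ := (s.choose (s / 2) : ℝ) / 2 ^ s

theorem midBinom_pos (s : ℕ) : 0 < midBinom s := by
  have : 0 < s.choose (s / 2) := Nat.choose_pos (Nat.div_le_self s 2)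
  unfold midBinom; positivity

theorem midBinom_two_mul (a : ℕ) : midBinom (2 * a) = (a.centralBinom : ℝ) / 2 ^ (2 * a) := by
  rw [midBinom, Nat.centralBinom, Nat.mul_div_cancel_left a two_pos]

theorem midBinom_two_mul_succ (a : ℕ) :
    midBinom (2 * (a + 1)) * (2 * a + 2) = midBinom (2 * a) * (2 * a + 1) := by
  have h := Nat.succ_mul_centralBinom_succ a
  have h' : ((a : ℝ) + 1) * (a + 1).centralBinom = 2 * (2 * a + 1) * a.centralBinom := by
    exact_mod_cast h
  rw [midBinom_two_mul, midBinom_two_mul, show 2 * (a + 1) = 2 * a + 2 by ring, pow_add]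
  field_simp
  linarith

theorem midBinom_odd (a : ℕ) : midBinom (2 * a + 1) = midBinom (2 * (a + 1)) := by
  have h : (2 * a + 2).choose (a + 1) = 2 * (2 * a + 1).choose a := by
    rw [Nat.choose_succ_succ' (2 * a + 1) a, Nat.choose_symm_half]; ring
  rw [midBinom, midBinom, show 2 * (a + 1) = 2 * a + 2 by ring,
    show (2 * a + 1) / 2 = a by omega, show (2 * a + 2) / 2 = a + 1 by omega, h, pow_succ _ (2*a+1)]
  push_cast
  field_simp

theorem midBinom_two_mul_sq_le (a : ℕ) : midBinom (2 * a) ^ 2 * (2 * a + 1) ≤ 1 := by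
  induction a with
  | zero => simp [midBinom]
  | succ a ih =>
    have h := midBinom_two_mul_succ a
    have e : midBinom (2 * (a + 1)) = midBinom (2 * a) * (2 * a + 1) / (2 * a + 2) := by
      rw [← h]; field_simp
    rw [e]
    push_cast
    have : (midBinom (2 * a) * (2 * a + 1) / (2 * a + 2)) ^ 2 * (2 * (a + 1) + 1)
        = (midBinom (2 * a) ^ 2 * (2 * a + 1)) * ((2 * a + 1) * (2 * a + 3) / (2 * a + 2) ^ 2) := by
      field_simp; ring
    rw [this]
    refine mul_le_one₀ ih (by positivity) ?_
    rw [div_le_one (by positivity)]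
    nlinarith

theorem midBinom_sq_le (s : ℕ) : midBinom s ^ 2 ≤ 1 / (s + 1) := by
  rw [le_div_iff₀ (by positivity)]
  obtain ⟨a, rfl | rfl⟩ := Nat.even_or_odd' s
  · simpa using midBinom_two_mul_sq_le a
  · rw [midBinom_odd]
    have := midBinom_two_mul_sq_le (a + 1)
    push_cast at this ⊢
    nlinarith [sq_nonneg (midBinom (2 * (a + 1)))]

theorem midBinom_sq_mul_mono {a l : ℕ} (hal : a ≤ l) :
    midBinom (2 * a) ^ 2 * a ≤ midBinom (2 * l) ^ 2 * l := by
  induction l, hal using Nat.le_induction with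
  | base => exact le_rfl
  | succ n hn ih =>
    refine ih.trans ?_
    have h := midBinom_two_mul_succ n
    have e : midBinom (2 * (n + 1)) = midBinom (2 * n) * (2 * n + 1) / (2 * n + 2) := by
      rw [← h]; field_simp
    have : (midBinom (2 * n) * (2 * n + 1) / (2 * n + 2)) ^ 2 * ((n + 1 : ℕ) : ℝ)
        = midBinom (2 * n) ^ 2 * ((2 * n + 1) ^ 2 / (4 * (n + 1))) := by
      push_cast; field_simp; ring
    rw [e, this]
    refine mul_le_mul_of_nonneg_left ?_ (sq_nonneg _)
    rw [le_div_iff₀ (by positivity)]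
    nlinarith

theorem le_midBinom_two_mul_sq {l : ℕ} (hl : 1 ≤ l) : 1 / (4 * l) ≤ midBinom (2 * l) ^ 2 := by
  have h := midBinom_sq_mul_mono hl
  have e : midBinom (2 * 1) = 1 / 2 := by simp [midBinom]; norm_num
  have hl' : (0 : ℝ) < l := by exact_mod_cast hl
  rw [e] at h
  rw [div_le_iff₀ (by positivity)]
  push_cast at h
  linarith

theorem midBinom_antitone : Antitone midBinom := by
  refine antitone_nat_of_succ_le fun s => ?_
  obtain ⟨a, rfl | rfl⟩ := Nat.even_or_odd' s
  · rw [midBinom_odd]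
    have h := midBinom_two_mul_succ a
    nlinarith [midBinom_pos (2 * a), midBinom_pos (2 * (a + 1))]
  · rw [midBinom_odd]; exact le_rfl

theorem midBinom_mul_le {d l : ℕ} (hl : 1 ≤ l) (hd : 9 * l ≤ 8 * d) (hd' : d ≤ 2 * l) :
    midBinom d * (3 / 4) ≤ midBinom (2 * l) := by
  have key : ∀ a, 9 * l ≤ 16 * a → a ≤ l → midBinom (2 * a) * (3 / 4) ≤ midBinom (2 * l) := by
    intro a ha hal
    have h := midBinom_sq_mul_mono hal
    have ha' : (9 : ℝ) * l ≤ 16 * a := by exact_mod_cast ha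
    have hl' : (0 : ℝ) < l := by exact_mod_cast hl
    refine (pow_le_pow_iff_left₀ (by have := midBinom_pos (2 * a); positivity) (midBinom_pos _).le two_ne_zero).1 ?_
    refine le_of_mul_le_mul_right ?_ hl'
    nlinarith [sq_nonneg (midBinom (2 * a))]
  obtain ⟨a, rfl | rfl⟩ := Nat.even_or_odd' d
  · exact key a (by omega) (by omega)
  · rw [midBinom_odd]; exact key (a + 1) (by omega) (by omega)

theorem choose_div_le_midBinom {g l : ℕ} (hg : g ≤ 2 * l) :
    (g.choose l : ℝ) / 2 ^ g ≤ midBinom (2 * l) := by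
  induction hg using Nat.decreasingInduction with
  | self => rw [midBinom, Nat.mul_div_cancel_left l two_pos]
  | of_succ k hk ih =>
    refine le_trans ?_ ih
    rw [div_le_div_iff₀ (by positivity) (by positivity), pow_succ]
    have : 2 * k.choose l ≤ (k + 1).choose l := by
      rcases l with _ | l
      · omega
      · have h := Nat.choose_succ_right_eq k l
        have h2 : k.choose (l + 1) ≤ k.choose l := by
          refine le_of_mul_le_mul_right (h.trans_le ?_) (Nat.succ_pos l)
          exact Nat.mul_le_mul_left _ (by omega)
        rw [Nat.choose_succ_succ' k l]; omega
    have h3 : (2 : ℝ) * k.choose l ≤ (k + 1).choose l := by exact_mod_cast this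
    have : (0 : ℝ) < 2 ^ k := by positivity
    nlinarith

theorem sum_sq_two_mul_card_sub {I : Type*} [DecidableEq I] (G : Finset I) :
    ∑ T ∈ G.powerset, (2 * (#T : ℝ) - (#G : ℝ)) ^ 2 = (#G : ℝ) * 2 ^ #G := by
  induction G using Finset.induction_on with
  | empty => simp
  | insert a G ha ih =>
    rw [sum_powerset_insert ha, card_insert_of_notMem ha, ← sum_add_distrib]
    have e2 : ∀ T ∈ G.powerset, (2 * (#T : ℝ) - ((#G + 1 : ℕ) : ℝ)) ^ 2 +
        (2 * (#(insert a T) : ℝ) - ((#G + 1 : ℕ) : ℝ)) ^ 2 =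
          2 * (2 * (#T : ℝ) - (#G : ℝ)) ^ 2 + 2 := by
      intro T hT
      rw [card_insert_of_notMem fun h => ha (mem_powerset.1 hT h)]
      push_cast; ring
    rw [sum_congr rfl e2, sum_add_distrib, ← mul_sum, ih]
    simp [pow_succ]; ring

theorem sum_union_of_disjoint_of_subset {I : Type*} [DecidableEq I] {Z G T : Finset I} (hZ : Disjoint Z G) (hT : T ⊆ G)
    (w : I → ℝ) : ∑ i ∈ Z ∪ T, w i = ∑ i ∈ Z, w i + ∑ i ∈ T, w i :=
  sum_union (hZ.mono_right hT)

section Density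
variable {I : Type*} [Fintype I]

/-- The proportion of subsets of `I` that belong to `F`. -/
noncomputable def density (F : Finset (Finset I)) : ℝ := (#F : ℝ) / 2 ^ Fintype.card I

theorem density_nonneg (F : Finset (Finset I)) : 0 ≤ density F := by
  unfold density; positivity

theorem density_mono {F F' : Finset (Finset I)} (h : F ⊆ F') : density F ≤ density F' := by
  unfold density; gcongr

theorem density_univ : density (univ : Finset (Finset I)) = 1 := by
  simp [density]

theorem density_le_one (F : Finset (Finset I)) : density F ≤ 1 :=
  density_univ (I := I) ▸ density_mono (subset_univ F)

variable [DecidableEq I]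

/-- Conditioning on the coordinates outside `G`. -/
theorem density_le_of_fiber (F F' : Finset (Finset I)) (G : Finset I) (c : ℝ)
    (hfib : ∀ Z, Disjoint Z G → (#{T ∈ G.powerset | Z ∪ T ∈ F} : ℝ) ≤ c * 2 ^ #G)
    (hsat : ∀ X ∈ F, ∀ T ⊆ G, X \ G ∪ T ∈ F') : density F ≤ c * density F' := by
  have hc : 0 ≤ c := by
    have h := hfib ∅ (disjoint_empty_left G)
    have h0 : (0 : ℝ) ≤ #{T ∈ G.powerset | ∅ ∪ T ∈ F} := by positivity
    have : (0 : ℝ) < 2 ^ #G := by positivity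
    exact nonneg_of_mul_nonneg_left (h0.trans h) this
  set Zs := F.image (· \ G) with hZs
  have h1 : (#F : ℝ) ≤ #Zs * (c * 2 ^ #G) := by
    have e : #F = ∑ Z ∈ Zs, #{X ∈ F | X \ G = Z} := card_eq_sum_card_image _ _
    rw [e]
    push_cast
    rw [← nsmul_eq_mul]
    refine sum_le_card_nsmul _ _ _ fun Z hZ => ?_
    obtain ⟨X₀, -, rfl⟩ := mem_image.1 hZ
    refine le_trans ?_ (hfib (X₀ \ G) sdiff_disjoint)
    refine Nat.cast_le.2 (card_le_card_of_injOn (· ∩ G) ?_ ?_)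
    · intro X hX
      have hX' := mem_filter.1 (mem_coe.1 hX)
      refine mem_coe.2 (mem_filter.2 ⟨mem_powerset.2 inter_subset_right, ?_⟩)
      rw [← hX'.2, sdiff_union_inter]; exact hX'.1
    · intro X hX X' hX' h
      have a1 := (mem_filter.1 (mem_coe.1 hX)).2
      have a2 := (mem_filter.1 (mem_coe.1 hX')).2
      rw [← sdiff_union_inter X G, ← sdiff_union_inter X' G, a1, a2]
      exact congrArg _ h
  have h2 : #Zs * 2 ^ #G ≤ #F' := by
    rw [← card_powerset, ← card_product]
    refine card_le_card_of_injOn (fun p => p.1 ∪ p.2) ?_ ?_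
    · rintro ⟨Z, T⟩ hp
      obtain ⟨hZ, hT⟩ := mem_product.1 (mem_coe.1 hp)
      obtain ⟨X, hX, rfl⟩ := mem_image.1 hZ
      exact hsat X hX T (mem_powerset.1 hT)
    · rintro ⟨Z, T⟩ hp ⟨Z', T'⟩ hp' h
      obtain ⟨hZ, hT⟩ := mem_product.1 (mem_coe.1 hp)
      obtain ⟨hZ', hT'⟩ := mem_product.1 (mem_coe.1 hp')
      obtain ⟨X, hX, rfl⟩ := mem_image.1 hZ
      obtain ⟨X', hX', rfl⟩ := mem_image.1 hZ'
      have t1 := mem_powerset.1 hT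
      have t2 := mem_powerset.1 hT'
      dsimp only at h t1 t2
      ext1
      · dsimp only
        have := congrArg (· \ G) h
        simpa [union_sdiff_distrib, sdiff_eq_empty_iff_subset.2 t1,
          sdiff_eq_empty_iff_subset.2 t2] using this
      · dsimp only
        have := congrArg (· ∩ G) h
        simpa [union_inter_distrib_right, inter_eq_left.2 t1, inter_eq_left.2 t2] using this
  have h2' : (#Zs : ℝ) * 2 ^ #G ≤ #F' := by exact_mod_cast h2
  unfold density
  rw [← mul_div_assoc]
  gcongr
  nlinarith

theorem density_le_of_sum_eq (F : Finset (Finset I)) (G : Finset I) (w : I → ℝ) (u : ℝ)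
    (hw : ∀ i ∈ G, w i ≠ 0) (hF : ∀ X ∈ F, ∑ i ∈ X, w i = u) : density F ≤ midBinom #G := by
  rw [← mul_one (midBinom #G), ← density_univ (I := I)]
  refine density_le_of_fiber F univ G _ (fun Z hZ => ?_) fun _ _ _ _ => mem_univ _
  rw [midBinom, div_mul_cancel₀ _ (by positivity)]
  refine Nat.cast_le.2 (card_sum_eq_le G w (u - ∑ i ∈ Z, w i) hw _ ?_ ?_)
  · intro T hT; exact mem_powerset.1 (mem_filter.1 hT).1
  · intro T hT
    have := hF _ (mem_filter.1 hT).2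
    rw [sum_union_of_disjoint_of_subset hZ (mem_powerset.1 (mem_filter.1 hT).1)] at this
    linarith

theorem density_le_of_sum_eq_or (F F' : Finset (Finset I)) (G : Finset I) (w : I → ℝ) (u u' : ℝ)
    (hw : ∀ i ∈ G, w i ≠ 0) (hF : ∀ X ∈ F, ∑ i ∈ X, w i = u ∨ ∑ i ∈ X, w i = u')
    (hsat : ∀ X ∈ F, ∀ T ⊆ G, X \ G ∪ T ∈ F') :
    density F ≤ 2 * midBinom #G * density F' := by
  refine density_le_of_fiber F F' G _ (fun Z hZ => ?_) hsat
  rw [midBinom, mul_assoc, div_mul_cancel₀ _ (by positivity)]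
  have key : ∀ v : ℝ, #{T ∈ G.powerset | Z ∪ T ∈ F ∧ ∑ i ∈ Z ∪ T, w i = v} ≤
      (#G).choose (#G / 2) := by
    intro v
    refine card_sum_eq_le G w (v - ∑ i ∈ Z, w i) hw _ ?_ ?_
    · intro T hT; exact mem_powerset.1 (mem_filter.1 hT).1
    · intro T hT
      have := (mem_filter.1 hT).2.2
      rw [sum_union_of_disjoint_of_subset hZ (mem_powerset.1 (mem_filter.1 hT).1)] at this
      linarith
  have h : #{T ∈ G.powerset | Z ∪ T ∈ F} ≤ 2 * (#G).choose (#G / 2) := by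
    rw [two_mul]
    refine le_trans (card_le_card ?_) ((card_union_le _ _).trans (add_le_add (key u) (key u')))
    intro T hT
    obtain ⟨h1, h2⟩ := mem_filter.1 hT
    rcases hF _ h2 with h3 | h3
    · exact mem_union_left _ (mem_filter.2 ⟨h1, h2, h3⟩)
    · exact mem_union_right _ (mem_filter.2 ⟨h1, h2, h3⟩)
  exact_mod_cast h

theorem density_le_of_two_sums (F : Finset (Finset I)) (G₁ G₂ : Finset I) (hd : Disjoint G₁ G₂)
    (β c : I → ℝ) (θ u v v' : ℝ)
    (hβ : ∀ i ∈ G₁ ∪ G₂, β i ≠ 0) (h₁ : ∀ i ∈ G₁, c i / β i ≤ θ) (h₂ : ∀ i ∈ G₂, θ < c i / β i)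
    (hu : ∀ X ∈ F, ∑ i ∈ X, β i = u)
    (hv : ∀ X ∈ F, ∑ i ∈ X, c i = v ∨ ∑ i ∈ X, c i = v') :
    density F ≤ 2 * (midBinom #G₁ * midBinom #G₂) := by
  rw [← mul_one (2 * _), ← density_univ (I := I)]
  refine density_le_of_fiber F univ (G₁ ∪ G₂) _ (fun Z hZ => ?_) fun _ _ _ _ => mem_univ _
  have key : ∀ t : ℝ, #{T ∈ (G₁ ∪ G₂).powerset | Z ∪ T ∈ F ∧ ∑ i ∈ Z ∪ T, c i = t} ≤
      (#G₁).choose (#G₁ / 2) * (#G₂).choose (#G₂ / 2) := by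
    intro t
    refine card_two_sums_le G₁ G₂ hd β c θ (u - ∑ i ∈ Z, β i) (t - ∑ i ∈ Z, c i) hβ h₁ h₂ _ ?_ ?_ ?_
    · intro T hT; exact mem_powerset.1 (mem_filter.1 hT).1
    · intro T hT
      have := hu _ (mem_filter.1 hT).2.1
      rw [sum_union_of_disjoint_of_subset hZ (mem_powerset.1 (mem_filter.1 hT).1)] at this
      linarith
    · intro T hT
      have := (mem_filter.1 hT).2.2
      rw [sum_union_of_disjoint_of_subset hZ (mem_powerset.1 (mem_filter.1 hT).1)] at this
      linarith
  have h : #{T ∈ (G₁ ∪ G₂).powerset | Z ∪ T ∈ F} ≤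
      2 * ((#G₁).choose (#G₁ / 2) * (#G₂).choose (#G₂ / 2)) := by
    rw [two_mul]
    refine le_trans (card_le_card ?_) ((card_union_le _ _).trans (add_le_add (key v) (key v')))
    intro T hT
    obtain ⟨h1, h2⟩ := mem_filter.1 hT
    rcases hv _ h2 with h3 | h3
    · exact mem_union_left _ (mem_filter.2 ⟨h1, h2, h3⟩)
    · exact mem_union_right _ (mem_filter.2 ⟨h1, h2, h3⟩)
  have h' : (#{T ∈ (G₁ ∪ G₂).powerset | Z ∪ T ∈ F} : ℝ) ≤
      2 * ((#G₁).choose (#G₁ / 2) * (#G₂).choose (#G₂ / 2)) := by exact_mod_cast h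
  refine h'.trans_eq ?_
  rw [card_union_of_disjoint hd, pow_add, midBinom, midBinom]
  field_simp

theorem density_le_of_sum_eq_of_abs_le_one (F : Finset (Finset I)) (w : I → ℝ) (l : ℕ)
    (hw : ∀ i, |w i| ≤ 1) (hF : ∀ X ∈ F, ∑ i ∈ X, w i = l) :
    density F ≤ midBinom (2 * l) := by
  set G : Finset I := {i | w i ≠ 0} with hG
  have hw0 : ∀ i ∈ G, w i ≠ 0 := fun i hi => (mem_filter.1 hi).2
  rcases le_total #G (2 * l) with h | h
  · refine le_trans ?_ (choose_div_le_midBinom h)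
    rw [← mul_one (_ / _), ← density_univ (I := I)]
    refine density_le_of_fiber F univ G _ (fun Z hZ => ?_) fun _ _ _ _ => mem_univ _
    have hZ0 : ∑ i ∈ Z, w i = 0 := sum_eq_zero fun i hi => by
      by_contra h0
      exact disjoint_left.1 hZ hi (mem_filter.2 ⟨mem_univ i, h0⟩)
    rw [div_mul_cancel₀ _ (by positivity)]
    refine Nat.cast_le.2 (card_sum_eq_le_choose G w l hw0 (fun i _ => hw i) h _ ?_ ?_)
    · intro T hT; exact mem_powerset.1 (mem_filter.1 hT).1
    · intro T hT
      have := hF _ (mem_filter.1 hT).2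
      rw [sum_union_of_disjoint_of_subset hZ (mem_powerset.1 (mem_filter.1 hT).1)] at this
      linarith
  · exact (density_le_of_sum_eq F G w l hw0 hF).trans (midBinom_antitone h)

/-- A fibre over one or two coordinates that is never full costs a factor `3 / 4`. -/
theorem density_le_of_fiber_ne (F F' : Finset (Finset I)) (G : Finset I) (hG : #G ≤ 2)
    (hne : ∀ Z, Disjoint Z G → ∃ T ⊆ G, Z ∪ T ∉ F)
    (hsat : ∀ X ∈ F, ∀ T ⊆ G, X \ G ∪ T ∈ F') : density F ≤ 3 / 4 * density F' := by
  refine density_le_of_fiber F F' G _ (fun Z hZ => ?_) hsat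
  obtain ⟨T, hT, hTF⟩ := hne Z hZ
  have h1 : #{T ∈ G.powerset | Z ∪ T ∈ F} < 2 ^ #G := by
    rw [← card_powerset]
    refine card_lt_card (filter_ssubset.2 ⟨T, mem_powerset.2 hT, hTF⟩)
  have h2 : (#{T ∈ G.powerset | Z ∪ T ∈ F} : ℝ) + 1 ≤ 2 ^ #G := by exact_mod_cast h1
  have h3 : (2 : ℝ) ^ #G ≤ 2 ^ 2 := pow_le_pow_right₀ one_le_two hG
  linarith

theorem density_le_of_large_inter (F : Finset (Finset I)) (G : Finset I) (hG : 0 < #G)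
    (hF : ∀ X ∈ F, 3 * (#G : ℝ) ≤ 4 * #(X ∩ G)) : density F ≤ 4 / #G := by
  rw [← mul_one (_ / _), ← density_univ (I := I)]
  refine density_le_of_fiber F univ G _ (fun Z hZ => ?_) fun _ _ _ _ => mem_univ _
  have hG' : (0 : ℝ) < #G := by exact_mod_cast hG
  have h : (#{T ∈ G.powerset | Z ∪ T ∈ F} : ℝ) * ((#G / 2) ^ 2) ≤ #G * 2 ^ #G := by
    rw [← sum_sq_two_mul_card_sub, ← nsmul_eq_mul]
    refine (card_nsmul_le_sum _ (fun T => (2 * (#T : ℝ) - #G) ^ 2) _ fun T hT => ?_).trans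
      (sum_le_sum_of_subset_of_nonneg (filter_subset _ _) fun _ _ _ => sq_nonneg _)
    obtain ⟨hT, hTF⟩ := mem_filter.1 hT
    have := hF _ hTF
    rw [union_inter_distrib_right, disjoint_iff_inter_eq_empty.1 hZ, empty_union,
      inter_eq_left.2 (mem_powerset.1 hT)] at this
    refine pow_le_pow_left₀ (by positivity) (by linarith) 2
  rw [div_mul_eq_mul_div, le_div_iff₀ hG']
  nlinarith

end Density

theorem sum_sdiff_union_eq {J : Type*} [DecidableEq J] {f : J → ℝ} {Q T : Finset J} (Y : Finset J)
    (hT : T ⊆ Q) (hf : ∀ j ∈ Q, f j = 0) : ∑ j ∈ Y \ Q ∪ T, f j = ∑ j ∈ Y, f j := by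
  rw [sum_union_of_disjoint_of_subset sdiff_disjoint hT, sum_eq_zero fun j hj => hf j (hT hj),
    add_zero]
  refine sum_subset sdiff_subset fun j hj hj' => hf j ?_
  by_contra h
  exact hj' (mem_sdiff.2 ⟨hj, h⟩)

theorem abs_sum_le_two_mul_card {J : Type*} [DecidableEq J] {f : J → ℝ} {Y S : Finset J}
    (hf : ∀ j, |f j| ≤ 2) (h : ∀ j ∈ Y, f j ≠ 0 → j ∈ S) : |∑ j ∈ Y, f j| ≤ 2 * #S := by
  have e : ∑ j ∈ Y, f j = ∑ j ∈ Y ∩ S, f j := by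
    refine (sum_subset inter_subset_left fun j hj hj' => ?_).symm
    by_contra h0
    exact hj' (mem_inter.2 ⟨hj, h j hj h0⟩)
  rw [e]
  calc |∑ j ∈ Y ∩ S, f j| ≤ ∑ j ∈ Y ∩ S, |f j| := abs_sum_le_sum_abs _ _
    _ ≤ #(Y ∩ S) • (2 : ℝ) := sum_le_card_nsmul _ _ _ fun j _ => hf j
    _ ≤ 2 * #S := by
      rw [nsmul_eq_mul, mul_comm]
      have : (#(Y ∩ S) : ℝ) ≤ #S := Nat.cast_le.2 (card_le_card inter_subset_right)
      linarith

theorem density_le_of_row {J : Type*} [Fintype J] [DecidableEq J] (F F' : Finset (Finset J))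
    (f : J → ℝ) (u : ℝ) (Q : Finset J) (hf : ∀ j ∈ Q, f j ≠ 0)
    (hQ : #Q = 2 ∨ #Q = 1 ∧ ∀ Z, Disjoint Z Q → u - ∑ j ∈ Z, f j ≠ 0 ∧ u - ∑ j ∈ Z, f j ≠ 1)
    (hF : ∀ Y ∈ F, ∑ j ∈ Y, f j = u ∨ ∑ j ∈ Y, f j = u - 1)
    (hsat : ∀ Y ∈ F, ∀ T ⊆ Q, Y \ Q ∪ T ∈ F') : density F ≤ 3 / 4 * density F' := by
  refine density_le_of_fiber_ne F F' Q (by omega) (fun Z hZ => ?_) hsat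
  by_contra! hfull
  have hs : ∀ T ⊆ Q, ∑ j ∈ Z, f j + ∑ j ∈ T, f j = u ∨ ∑ j ∈ Z, f j + ∑ j ∈ T, f j = u - 1 := by
    intro T hT
    rw [← sum_union_of_disjoint_of_subset hZ hT]
    exact hF _ (hfull T hT)
  have h0 := hs ∅ (empty_subset _)
  rw [sum_empty, add_zero] at h0
  rcases hQ with hQ | ⟨-, hQ⟩
  · obtain ⟨a, c, hac, rfl⟩ := card_eq_two.1 hQ
    have h1 := hs {a} (by simp)
    have h2 := hs {c} (by simp)
    have h3 := hs {a, c} subset_rfl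
    have ha := hf a (by simp)
    have hc := hf c (by simp)
    rw [sum_singleton] at h1 h2
    rw [sum_pair hac] at h3
    rcases h0 with h0 | h0 <;> rcases h1 with h1 | h1 <;> rcases h2 with h2 | h2 <;>
      rcases h3 with h3 | h3 <;>
      first
        | exact ha (by linarith)
        | exact hc (by linarith)
  · have := hQ Z hZ
    rcases h0 with h0 | h0
    · exact this.1 (by linarith)
    · exact this.2 (by linarith)

/-- If every threshold splits `S` unevenly, then `s` is constant on most of `S`. -/
theorem exists_common_value {I : Type*} (S : Finset I) (s : I → ℝ) (C : ℕ)
    (hC : 0 < C) (hS : C ≤ #S)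
    (h : ∀ θ, #{i ∈ S | s i ≤ θ} < C ∨ #{i ∈ S | θ < s i} < C) :
    ∃ v, #{i ∈ S | s i ≠ v} < 2 * C := by
  classical
  set V := (S.image s).filter (fun v => C ≤ #{i ∈ S | s i ≤ v}) with hV
  have hSne : (S.image s).Nonempty := (card_pos.1 (hC.trans_le hS)).image s
  have hVne : V.Nonempty := by
    refine ⟨(S.image s).max' hSne, mem_filter.2 ⟨max'_mem _ _, ?_⟩⟩
    rwa [filter_true_of_mem fun i hi => le_max' _ _ (mem_image_of_mem s hi)]
  set v := V.min' hVne with hv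
  have hvV := (mem_filter.1 (min'_mem V hVne)).2
  refine ⟨v, ?_⟩
  have h1 : #{i ∈ S | v < s i} < C := (h v).resolve_left (not_lt.2 hvV)
  have h2 : #{i ∈ S | s i < v} < C := by
    by_contra! hge
    have hne : ({i ∈ S | s i < v}.image s).Nonempty := (card_pos.1 (hC.trans_le hge)).image s
    set θ := ({i ∈ S | s i < v}.image s).max' hne with hθ
    obtain ⟨i, hi, hiθ⟩ := mem_image.1 (max'_mem _ hne)
    rw [← hθ] at hiθ
    obtain ⟨hiS, hiv⟩ := mem_filter.1 hi
    have : θ ∈ V := by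
      refine mem_filter.2 ⟨hiθ ▸ mem_image_of_mem s hiS, hge.trans (card_le_card ?_)⟩
      intro k hk
      exact mem_filter.2 ⟨(mem_filter.1 hk).1, le_max' _ _ (mem_image_of_mem s hk)⟩
    have := min'_le V θ this
    rw [← hv] at this
    linarith
  have h3 : {i ∈ S | s i ≠ v} ⊆ {i ∈ S | s i < v} ∪ {i ∈ S | v < s i} := by
    intro i hi
    obtain ⟨hi, hne⟩ := mem_filter.1 hi
    rcases lt_or_gt_of_ne hne with h | h
    · exact mem_union_left _ (mem_filter.2 ⟨hi, h⟩)
    · exact mem_union_right _ (mem_filter.2 ⟨hi, h⟩)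
  have := (card_le_card h3).trans (card_union_le _ _)
  omega

/-- The linear relations obeyed by a cross-intersecting pair written in a basis `I` of
coordinates, the remaining coordinates being `J`. -/
structure IsSystem {I J : Type*} (N : I → J → ℝ) (β : I → ℝ) (l : ℕ)
    (𝒜 : Finset (Finset I)) (ℬ : Finset (Finset J)) : Prop where
  sum_eq : ∀ X ∈ 𝒜, ∑ i ∈ X, β i = l
  col : ∀ X ∈ 𝒜, ∀ j, ∑ i ∈ X, N i j = 0 ∨ ∑ i ∈ X, N i j = 1
  row : ∀ Y ∈ ℬ, ∀ i, ∑ j ∈ Y, N i j = β i ∨ ∑ j ∈ Y, N i j = β i - 1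

section System
variable {I J : Type*} [Fintype I] [Fintype J]

/-- The support of a real function on a finite type. -/
noncomputable def suppt (f : I → ℝ) : Finset I := {i | f i ≠ 0}

theorem mem_suppt {f : I → ℝ} {i : I} : i ∈ suppt f ↔ f i ≠ 0 := by simp [suppt]

variable [DecidableEq I] [DecidableEq J]
variable {N : I → J → ℝ} {β : I → ℝ} {l : ℕ} {𝒜 : Finset (Finset I)} {ℬ : Finset (Finset J)}

namespace IsSystem

theorem density_left_sq_le (h : IsSystem N β l 𝒜 ℬ) :
    density 𝒜 ^ 2 ≤ 1 / (#(suppt β) + 1) :=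
  (pow_le_pow_left₀ (density_nonneg _) (density_le_of_sum_eq 𝒜 (suppt β) β l
    (fun _ => mem_suppt.1) h.sum_eq) 2).trans (midBinom_sq_le _)

theorem density_right_le (h : IsSystem N β l 𝒜 ℬ) (i : I) {S : Finset J} (hS : S ⊆ suppt (N i)) :
    density ℬ ≤ 2 * midBinom #S := by
  have := density_le_of_sum_eq_or ℬ univ S (N i) (β i) (β i - 1)
    (fun j hj => mem_suppt.1 (hS hj)) (fun Y hY => h.row Y hY i) fun _ _ _ _ => mem_univ _
  rwa [density_univ, mul_one] at this

theorem density_right_sq_le (h : IsSystem N β l 𝒜 ℬ) (i : I) :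
    density ℬ ^ 2 * (#(suppt (N i)) + 1) ≤ 4 := by
  have h1 := pow_le_pow_left₀ (density_nonneg _) (h.density_right_le i subset_rfl) 2
  have h2 := midBinom_sq_le #(suppt (N i))
  rw [le_div_iff₀ (by positivity)] at h2
  rw [mul_pow] at h1
  have : (0 : ℝ) < #(suppt (N i)) + 1 := by positivity
  nlinarith

theorem abs_le_of_row (h : IsSystem N β l 𝒜 ℬ) (hN : ∀ i j, |N i j| ≤ 2) (hℬ : ℬ.Nonempty)
    (i : I) : |β i| ≤ 1 + 2 * #(suppt (N i)) := by
  obtain ⟨Y, hY⟩ := hℬ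
  have h1 := abs_le.1 (abs_sum_le_two_mul_card (Y := Y) (hN i) fun j _ hj => mem_suppt.2 hj)
  rw [abs_le]
  rcases h.row Y hY i with h2 | h2 <;> constructor <;> linarith

theorem density_right_le_of_one_lt (h : IsSystem N β l 𝒜 ℬ) (hN : ∀ i j, |N i j| ≤ 2)
    {i : I} (hi : 1 < |β i|) : density ℬ ≤ 3 / 4 := by
  rcases ℬ.eq_empty_or_nonempty with rfl | hℬ
  · simp only [density, card_empty, Nat.cast_zero, zero_div]; norm_num
  have h0 := h.abs_le_of_row hN hℬ i
  have hm : 0 < #(suppt (N i)) := by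
    have : (0 : ℝ) < #(suppt (N i)) := by linarith
    exact_mod_cast this
  have key : ∀ Q : Finset J, Q ⊆ suppt (N i) →
      (#Q = 2 ∨ #Q = 1 ∧ ∀ Z, Disjoint Z Q → β i - ∑ j ∈ Z, N i j ≠ 0 ∧
        β i - ∑ j ∈ Z, N i j ≠ 1) → density ℬ ≤ 3 / 4 := by
    intro Q hQ hQ'
    have := density_le_of_row ℬ univ (N i) (β i) Q (fun j hj => mem_suppt.1 (hQ hj)) hQ'
      (fun Y hY => h.row Y hY i) fun _ _ _ _ => mem_univ _
    rwa [density_univ, mul_one] at this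
  rcases Nat.lt_or_ge #(suppt (N i)) 2 with h2 | h2
  · refine key _ subset_rfl (Or.inr ⟨by omega, fun Z hZ => ?_⟩)
    rw [sum_eq_zero fun j hj => by_contra fun hj' => disjoint_left.1 hZ hj (mem_suppt.2 hj'),
      sub_zero]
    constructor <;> intro hb <;> rw [hb] at hi <;> norm_num at hi
  · obtain ⟨Q, hQ, hQ'⟩ := exists_subset_card_eq h2
    exact key Q hQ (Or.inl hQ')

end IsSystem
end System

section System
variable {I J : Type*} [Fintype I] [Fintype J]
variable [DecidableEq I] [DecidableEq J]
variable {N : I → J → ℝ} {β : I → ℝ} {l : ℕ} {𝒜 : Finset (Finset I)} {ℬ : Finset (Finset J)}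

namespace IsSystem

theorem density_left_sq_mul_zero_le (h : IsSystem N β l 𝒜 ℬ) (j : J) :
    density 𝒜 ^ 2 * ((#{i | β i = 0 ∧ N i j ≠ 0} + 1) * (#(suppt β) + 1)) ≤ 4 := by
  set O : Finset I := {i | β i = 0 ∧ N i j ≠ 0} with hO
  have h1 := density_le_of_sum_eq_or 𝒜 {X | ∑ i ∈ X, β i = l} O (fun i => N i j) 0 1
    (fun i hi => (mem_filter.1 hi).2.2) (fun X hX => h.col X hX j) (by
      intro X hX T hT
      refine mem_filter.2 ⟨mem_univ _, ?_⟩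
      rw [sum_sdiff_union_eq X hT fun i hi => (mem_filter.1 hi).2.1, h.sum_eq X hX])
  have h2 := density_le_of_sum_eq {X | ∑ i ∈ X, β i = l} (suppt β) β l
    (fun _ => mem_suppt.1) fun X hX => (mem_filter.1 hX).2
  have h3 : density 𝒜 ≤ 2 * midBinom #O * midBinom #(suppt β) :=
    h1.trans (mul_le_mul_of_nonneg_left h2 (by have := midBinom_pos #O; positivity))
  have h4 := midBinom_sq_le #O
  have h5 := midBinom_sq_le #(suppt β)
  rw [le_div_iff₀ (by positivity)] at h4 h5
  have h6 := pow_le_pow_left₀ (density_nonneg _) h3 2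
  calc density 𝒜 ^ 2 * ((#O + 1) * (#(suppt β) + 1))
      ≤ (2 * midBinom #O * midBinom #(suppt β)) ^ 2 * ((#O + 1) * (#(suppt β) + 1)) := by gcongr
    _ = 4 * ((midBinom #O ^ 2 * (#O + 1)) * (midBinom #(suppt β) ^ 2 * (#(suppt β) + 1))) := by ring
    _ ≤ 4 * (1 * 1) := by gcongr
    _ = 4 := by norm_num

theorem density_left_sq_mul_split_le (h : IsSystem N β l 𝒜 ℬ) (j : J) (θ : ℝ) :
    density 𝒜 ^ 2 * ((#{i ∈ suppt β | N i j / β i ≤ θ} + 1) *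
      (#{i ∈ suppt β | θ < N i j / β i} + 1)) ≤ 4 := by
  set G₁ := {i ∈ suppt β | N i j / β i ≤ θ} with hG₁
  set G₂ := {i ∈ suppt β | θ < N i j / β i} with hG₂
  have h3 := density_le_of_two_sums 𝒜 G₁ G₂
    (disjoint_left.2 fun i hi hi' => not_lt.2 (mem_filter.1 hi).2 (mem_filter.1 hi').2)
    β (fun i => N i j) θ l 0 1 (by
      intro i hi
      rcases mem_union.1 hi with hi | hi <;> exact mem_suppt.1 (mem_filter.1 hi).1)
    (fun i hi => (mem_filter.1 hi).2) (fun i hi => (mem_filter.1 hi).2) h.sum_eq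
    fun X hX => h.col X hX j
  have h4 := midBinom_sq_le #G₁
  have h5 := midBinom_sq_le #G₂
  rw [le_div_iff₀ (by positivity)] at h4 h5
  have h6 := pow_le_pow_left₀ (density_nonneg _) h3 2
  calc density 𝒜 ^ 2 * ((#G₁ + 1) * (#G₂ + 1))
      ≤ (2 * (midBinom #G₁ * midBinom #G₂)) ^ 2 * ((#G₁ + 1) * (#G₂ + 1)) := by gcongr
    _ = 4 * ((midBinom #G₁ ^ 2 * (#G₁ + 1)) * (midBinom #G₂ ^ 2 * (#G₂ + 1))) := by ring
    _ ≤ 4 * (1 * 1) := by gcongr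
    _ = 4 := by norm_num

theorem card_zero_lt (h : IsSystem N β l 𝒜 ℬ) (hA : 1 < 3200 * #(suppt β) * density 𝒜 ^ 2)
    (j : J) : #{i | β i = 0 ∧ N i j ≠ 0} < 25600 := by
  have h1 := h.density_left_sq_mul_zero_le j
  set O : Finset I := {i | β i = 0 ∧ N i j ≠ 0}
  have h2 : (#O : ℝ) < 25600 := by
    by_contra! hge
    have : density 𝒜 ^ 2 * ((25600 + 1) * (#(suppt β) + 1)) ≤ 4 :=
      le_trans (by gcongr) h1
    nlinarith [sq_nonneg (density 𝒜)]
  exact_mod_cast h2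

theorem exists_slope (h : IsSystem N β l 𝒜 ℬ) (hA : 1 < 3200 * #(suppt β) * density 𝒜 ^ 2)
    (hd : 51200 ≤ #(suppt β)) (j : J) :
    ∃ v, #{i ∈ suppt β | N i j ≠ v * β i} < 51200 := by
  obtain ⟨v, hv⟩ := exists_common_value (suppt β) (fun i => N i j / β i) 25600 (by norm_num)
    (by omega) (by
      intro θ
      have h1 := h.density_left_sq_mul_split_le j θ
      have h2 : #(suppt β) = #{i ∈ suppt β | N i j / β i ≤ θ} +
          #{i ∈ suppt β | θ < N i j / β i} := by
        simp only [← not_le]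
        exact (card_filter_add_card_filter_not _).symm
      set a := #{i ∈ suppt β | N i j / β i ≤ θ}
      set b := #{i ∈ suppt β | θ < N i j / β i}
      have h2' : (#(suppt β) : ℝ) = a + b := by exact_mod_cast h2
      by_contra! hge
      have ha : (25600 : ℝ) ≤ a := by exact_mod_cast hge.1
      have hb : (25600 : ℝ) ≤ b := by exact_mod_cast hge.2
      have hab : 12800 * ((a : ℝ) + b) ≤ (a + 1) * (b + 1) := by nlinarith
      rw [h2'] at hA
      nlinarith [mul_le_mul_of_nonneg_left hab (sq_nonneg (density 𝒜))])
  refine ⟨v, lt_of_le_of_lt (card_le_card ?_) hv⟩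
  intro i hi
  obtain ⟨hi, hne⟩ := mem_filter.1 hi
  refine mem_filter.2 ⟨hi, fun he => hne ?_⟩
  rw [← he, div_mul_cancel₀ _ (mem_suppt.1 hi)]

theorem card_le_card_large (h : IsSystem N β l 𝒜 ℬ) {w : ℝ} (hw : 0 < w)
    (hwd : w * #(suppt β) = l) (hl : 256 ≤ (l : ℝ)) (hd : (#(suppt β) : ℝ) ≤ 9 / 8 * l)
    (hA : 1 < 4 * l * density 𝒜 ^ 2) (hβ : ∀ i, β i ≤ 34 * w) :
    (#(suppt β) : ℝ) ≤ 340 * #{i | 1.01 + w / 100 ≤ β i} := by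
  set P : Finset I := {i | 1.01 + w / 100 ≤ β i} with hP
  have hd0 : (0 : ℝ) < #(suppt β) := by
    by_contra! h0
    nlinarith
  have h𝒜 : 𝒜.Nonempty := by
    by_contra! h0
    rw [h0] at hA
    simp only [density, card_empty, Nat.cast_zero] at hA
    norm_num at hA
  obtain ⟨X, hX, hX'⟩ : ∃ X ∈ 𝒜, #(X ∩ suppt β) * (1.01 + w / 100) ≤ 0.9 * (l : ℝ) := by
    rcases le_total (#(suppt β) : ℝ) (l / 2) with hc | hc
    · obtain ⟨X, hX⟩ := h𝒜
      refine ⟨X, hX, ?_⟩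
      have : (#(X ∩ suppt β) : ℝ) ≤ #(suppt β) := Nat.cast_le.2 (card_le_card inter_subset_right)
      nlinarith
    · by_contra! hall
      have h1 := density_le_of_large_inter 𝒜 (suppt β) (by exact_mod_cast hd0) (by
        intro X hX
        have := hall X hX
        by_contra! hlt
        nlinarith)
      rw [le_div_iff₀ hd0] at h1
      have h2 : density 𝒜 * l ≤ 8 := by nlinarith [density_nonneg 𝒜]
      have h3 : 0 ≤ density 𝒜 * l := mul_nonneg (density_nonneg _) (by linarith)
      have h4 : (density 𝒜 * l) ^ 2 ≤ 64 := by nlinarith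
      nlinarith
  have h1 : (l : ℝ) ≤ #(X ∩ suppt β) * (1.01 + w / 100) + #P * (34 * w) := by
    rw [← h.sum_eq X hX]
    calc ∑ i ∈ X, β i ≤ ∑ i ∈ X, ((if i ∈ suppt β then 1.01 + w / 100 else 0) +
          if i ∈ P then 34 * w else 0) := by
          refine sum_le_sum fun i _ => ?_
          by_cases hi : i ∈ P
          · rw [if_pos hi]
            have := hβ i
            split_ifs <;> nlinarith
          · rw [if_neg hi, add_zero]
            split_ifs with h0
            · by_contra! hlt
              exact hi (mem_filter.2 ⟨mem_univ _, hlt.le⟩)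
            · exact (by_contra fun hne => h0 (mem_suppt.2 hne) : β i = 0).le
      _ = #(X ∩ suppt β) * (1.01 + w / 100) + #(X ∩ P) * (34 * w) := by
          rw [sum_add_distrib, ← sum_filter, ← sum_filter, sum_const, sum_const,
            filter_mem_eq_inter, filter_mem_eq_inter, nsmul_eq_mul, nsmul_eq_mul]
      _ ≤ _ := by
          have : (#(X ∩ P) : ℝ) ≤ #P := Nat.cast_le.2 (card_le_card inter_subset_right)
          gcongr
  have h2 : w * #(suppt β) ≤ w * (340 * #P) := by rw [hwd]; linarith
  exact le_of_mul_le_mul_left h2 hw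

/-- The common slope of a column is small. -/
theorem abs_slope_mul_le (h : IsSystem N β l 𝒜 ℬ) (hN : ∀ i j, |N i j| ≤ 2) (h𝒜 : 𝒜.Nonempty)
    {w : ℝ} (hw : 8 / 9 ≤ w) (hβ : ∀ i, |β i| ≤ 34 * w)
    {P : Finset I} (hP : ∀ i ∈ P, 1.01 + w / 100 ≤ β i) (hP' : 51200 ≤ #P) {j : J} {v : ℝ}
    (hO : #{i | β i = 0 ∧ N i j ≠ 0} < 25600)
    (hv : #{i ∈ suppt β | N i j ≠ v * β i} < 51200) : |v| * l ≤ 400000000 := by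
  set O : Finset I := {i | β i = 0 ∧ N i j ≠ 0} with hOdef
  set E := {i ∈ suppt β | N i j ≠ v * β i} with hE
  obtain ⟨i, hi, hiE⟩ : ∃ i ∈ P, i ∉ E := by
    by_contra! hsub
    exact absurd (card_le_card hsub) (by omega)
  have hβi := hP i hi
  have hi0 : i ∈ suppt β := mem_suppt.2 (by intro h0; rw [h0] at hβi; linarith)
  have hiv : N i j = v * β i := by
    by_contra hne
    exact hiE (mem_filter.2 ⟨hi0, hne⟩)
  have hvw : |v| * w ≤ 200 := by
    have h2 := hN i j
    rw [hiv, abs_mul, abs_of_pos (by linarith : 0 < β i)] at h2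
    nlinarith [abs_nonneg v]
  obtain ⟨X, hX⟩ := h𝒜
  have h1 : |v * l| ≤ |∑ i ∈ X, N i j| + |∑ i ∈ X, (N i j - v * β i)| := by
    rw [← h.sum_eq X hX, mul_sum, sum_sub_distrib]
    set a := ∑ i ∈ X, N i j
    set b := ∑ i ∈ X, v * β i
    calc |b| = |a - (a - b)| := by ring_nf
      _ ≤ _ := abs_sub _ _
  have h2 : |∑ i ∈ X, N i j| ≤ 1 := by
    rcases h.col X hX j with h0 | h0 <;> rw [h0] <;> norm_num
  have h3 : |∑ i ∈ X, (N i j - v * β i)| ≤ #O * 2 + #E * 6802 := by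
    calc |∑ i ∈ X, (N i j - v * β i)| ≤ ∑ i ∈ X, |N i j - v * β i| := abs_sum_le_sum_abs _ _
      _ ≤ ∑ i ∈ X, ((if i ∈ O then (2 : ℝ) else 0) + if i ∈ E then 6802 else 0) := by
          refine sum_le_sum fun i _ => ?_
          by_cases h0 : β i = 0
          · have : i ∉ E := fun h => mem_suppt.1 (mem_filter.1 h).1 h0
            rw [if_neg this, h0, mul_zero, sub_zero, add_zero]
            by_cases hn : N i j = 0
            · rw [hn, abs_zero]; split_ifs <;> norm_num
            · rw [if_pos (mem_filter.2 ⟨mem_univ _, h0, hn⟩)]; exact hN i j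
          · by_cases hn : N i j = v * β i
            · rw [hn, sub_self, abs_zero]; split_ifs <;> norm_num
            · rw [if_pos (mem_filter.2 ⟨mem_suppt.2 h0, hn⟩ : i ∈ E)]
              have h5 := abs_sub (N i j) (v * β i)
              rw [abs_mul] at h5
              have h6 : |v| * |β i| ≤ 6800 := by
                nlinarith [mul_le_mul_of_nonneg_left (hβ i) (abs_nonneg v)]
              have := hN i j
              split_ifs <;> linarith
      _ = #(X ∩ O) * 2 + #(X ∩ E) * 6802 := by
          rw [sum_add_distrib, ← sum_filter, ← sum_filter, sum_const, sum_const,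
            filter_mem_eq_inter, filter_mem_eq_inter, nsmul_eq_mul, nsmul_eq_mul]
      _ ≤ _ := by
          have a1 : (#(X ∩ O) : ℝ) ≤ #O := Nat.cast_le.2 (card_le_card inter_subset_right)
          have a2 : (#(X ∩ E) : ℝ) ≤ #E := Nat.cast_le.2 (card_le_card inter_subset_right)
          gcongr
  have h4 : (#O : ℝ) ≤ 25600 := by exact_mod_cast hO.le
  have h5 : (#E : ℝ) ≤ 51200 := by exact_mod_cast hv.le
  rw [abs_mul, Nat.abs_cast] at h1
  linarith

end IsSystem
end System

section System
variable {I J : Type*} [Fintype I] [Fintype J]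
variable [DecidableEq I] [DecidableEq J]
variable {N : I → J → ℝ} {β : I → ℝ} {l : ℕ} {𝒜 : Finset (Finset I)} {ℬ : Finset (Finset J)}

/-- The sets of columns that satisfy the row conditions of a system for all rows in `R`. -/
noncomputable def rowSat (N : I → J → ℝ) (β : I → ℝ) (R : Finset I) : Finset (Finset J) :=
  {Y | ∀ i ∈ R, ∑ j ∈ Y, N i j = β i ∨ ∑ j ∈ Y, N i j = β i - 1}

theorem mem_rowSat {R : Finset I} {Y : Finset J} :
    Y ∈ rowSat N β R ↔ ∀ i ∈ R, ∑ j ∈ Y, N i j = β i ∨ ∑ j ∈ Y, N i j = β i - 1 := by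
  simp [rowSat]

theorem exists_rows_density_le {P : Finset I} {S : Finset J} {w : ℝ} (hw : 0 < w)
    (hβ : ∀ i ∈ P, 1.01 + w / 100 ≤ β i) (hS : ∀ i ∈ P, ∑ j ∈ S, |N i j| ≤ w / 200)
    (hcol : ∀ j ∉ S, #{i ∈ P | N i j ≠ 0} ≤ 51200) (hm : ∀ i, #(suppt (N i)) ≤ 16 * w)
    (hs : ∀ i ∈ P, 1 ≤ #(suppt (N i) \ S) ∧ w / 400 ≤ #(suppt (N i) \ S)) (q : ℕ)
    (hq : 655360000 * q < #P) :
    ∃ R ⊆ P, #R ≤ q + 1 ∧ density (rowSat N β R) ^ 2 ≤ ((3 / 4) ^ q) ^ 2 * (1600 / w) := by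
  induction q with
  | zero =>
    obtain ⟨i, hi⟩ := card_pos.1 (by omega : 0 < #P)
    refine ⟨{i}, singleton_subset_iff.2 hi, by simp, ?_⟩
    set s := suppt (N i) \ S with hsdef
    have h1 := density_le_of_sum_eq_or (rowSat N β {i}) univ s (N i) (β i) (β i - 1)
      (fun j hj => mem_suppt.1 (mem_sdiff.1 hj).1)
      (fun Y hY => mem_rowSat.1 hY i (mem_singleton_self i)) fun _ _ _ _ => mem_univ _
    rw [density_univ, mul_one] at h1
    have h2 := midBinom_sq_le #s
    rw [le_div_iff₀ (by positivity)] at h2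
    have h3 := pow_le_pow_left₀ (density_nonneg _) h1 2
    rw [pow_zero, one_pow, one_mul, le_div_iff₀ hw]
    have := (hs i hi).2
    nlinarith [sq_nonneg (midBinom #s)]
  | succ q ih =>
    obtain ⟨R, hRP, hR, hRd⟩ := ih (by omega)
    set U := R.biUnion (fun r => suppt (N r) \ S) with hU
    have hUcard : (#U : ℝ) ≤ 16 * w * (q + 1) := by
      have h1 : (#U : ℝ) ≤ ∑ r ∈ R, (#(suppt (N r) \ S) : ℝ) := by
        exact_mod_cast card_biUnion_le
      have h2 : ∑ r ∈ R, (#(suppt (N r) \ S) : ℝ) ≤ #R • (16 * w) :=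
        sum_le_card_nsmul _ _ _ fun r _ =>
          le_trans (Nat.cast_le.2 (card_le_card sdiff_subset)) (hm r)
      have h3 : (#R : ℝ) ≤ q + 1 := by exact_mod_cast hR
      rw [nsmul_eq_mul] at h2
      nlinarith
    obtain ⟨i, hi, hi'⟩ : ∃ i ∈ P, (suppt (N i) \ S) ∩ U = ∅ ∨ 2 ≤ #((suppt (N i) \ S) \ U) := by
      by_contra! hblock
      have h1 : ∀ i ∈ P, w / 800 ≤ (#((suppt (N i) \ S) ∩ U) : ℝ) := by
        intro i hi
        obtain ⟨h1, h2⟩ := hblock i hi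
        have h3 : 1 ≤ #((suppt (N i) \ S) ∩ U) := card_pos.2 h1
        have h4 := card_sdiff_add_card_inter (suppt (N i) \ S) U
        have h5 : (#(suppt (N i) \ S) : ℝ) ≤ 2 * #((suppt (N i) \ S) ∩ U) := by
          exact_mod_cast (by omega : #(suppt (N i) \ S) ≤ 2 * #((suppt (N i) \ S) ∩ U))
        have := (hs i hi).2
        linarith
      have h2 : (#P : ℝ) * (w / 800) ≤ ∑ i ∈ P, (#((suppt (N i) \ S) ∩ U) : ℝ) := by
        rw [← nsmul_eq_mul]
        exact card_nsmul_le_sum _ _ _ h1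
      have h3 : ∑ i ∈ P, #((suppt (N i) \ S) ∩ U) ≤ #U * 51200 := by
        have e : ∀ i ∈ P, #((suppt (N i) \ S) ∩ U) ≤ #(bipartiteAbove (fun i j => N i j ≠ 0) U i) := by
          intro i _
          refine card_le_card fun j hj => ?_
          obtain ⟨hj1, hj2⟩ := mem_inter.1 hj
          exact (mem_bipartiteAbove _).2 ⟨hj2, mem_suppt.1 (mem_sdiff.1 hj1).1⟩
        refine (sum_le_sum e).trans ?_
        rw [sum_card_bipartiteAbove_eq_sum_card_bipartiteBelow, ← smul_eq_mul]
        refine sum_le_card_nsmul _ _ _ fun j hj => ?_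
        obtain ⟨r, -, hr⟩ := mem_biUnion.1 hj
        exact hcol j (mem_sdiff.1 hr).2
      have h3' : ∑ i ∈ P, (#((suppt (N i) \ S) ∩ U) : ℝ) ≤ #U * 51200 := by exact_mod_cast h3
      have h4 : (655360000 : ℝ) * (q + 1) < #P := by exact_mod_cast hq
      nlinarith
    have hQ : ∃ Q ⊆ (suppt (N i) \ S) \ U, #Q = 2 ∨ #Q = 1 ∧ Q = suppt (N i) \ S := by
      rcases Nat.lt_or_ge #((suppt (N i) \ S) \ U) 2 with h2 | h2
      · have h3 := hi'.resolve_right (not_le.2 h2)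
        rw [sdiff_eq_self_of_disjoint (disjoint_iff_inter_eq_empty.2 h3)] at h2 ⊢
        exact ⟨_, subset_rfl, Or.inr ⟨le_antisymm (by omega) (hs i hi).1, rfl⟩⟩
      · obtain ⟨Q, hQ, hQ'⟩ := exists_subset_card_eq h2
        exact ⟨Q, hQ, Or.inl hQ'⟩
    obtain ⟨Q, hQs, hQ⟩ := hQ
    have h1 := density_le_of_row (rowSat N β (insert i R)) (rowSat N β R) (N i) (β i) Q
      (fun j hj => mem_suppt.1 (mem_sdiff.1 (mem_sdiff.1 (hQs hj)).1).1)
      (hQ.imp_right fun ⟨hQ1, hQ2⟩ => ⟨hQ1, fun Z hZ => by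
        have hle : ∑ j ∈ Z, N i j ≤ w / 200 := by
          refine le_trans ?_ (hS i hi)
          have e : ∑ j ∈ Z, N i j = ∑ j ∈ Z ∩ S, N i j := by
            refine (sum_subset inter_subset_left fun j hj hj' => ?_).symm
            by_contra h0
            refine disjoint_left.1 hZ hj ?_
            rw [hQ2]
            exact mem_sdiff.2 ⟨mem_suppt.2 h0, fun hjS => hj' (mem_inter.2 ⟨hj, hjS⟩)⟩
          rw [e]
          exact (sum_le_sum fun j _ => le_abs_self _).trans
            (sum_le_sum_of_subset_of_nonneg inter_subset_right fun _ _ _ => abs_nonneg _)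
        have := hβ i hi
        constructor <;> intro h0 <;> linarith⟩)
      (fun Y hY => mem_rowSat.1 hY i (mem_insert_self i R))
      (by
        intro Y hY T hT
        refine mem_rowSat.2 fun r hr => ?_
        rw [sum_sdiff_union_eq Y hT]
        · exact mem_rowSat.1 hY r (mem_insert_of_mem hr)
        · intro j hj
          have hj' := hQs hj
          by_contra h0
          exact (mem_sdiff.1 hj').2 (mem_biUnion.2 ⟨r, hr, mem_sdiff.2 ⟨mem_suppt.2 h0,
            (mem_sdiff.1 (mem_sdiff.1 hj').1).2⟩⟩))
    refine ⟨insert i R, insert_subset hi hRP, (card_insert_le _ _).trans (by omega), ?_⟩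
    have h2 := pow_le_pow_left₀ (density_nonneg _) h1 2
    calc _ ≤ _ := h2
      _ = (3 / 4) ^ 2 * density (rowSat N β R) ^ 2 := by ring
      _ ≤ (3 / 4) ^ 2 * (((3 / 4) ^ q) ^ 2 * (1600 / w)) := by gcongr
      _ = _ := by ring

end System

section System
variable {I J : Type*} [Fintype I] [Fintype J]
variable [DecidableEq I] [DecidableEq J]
variable {N : I → J → ℝ} {β : I → ℝ} {l : ℕ} {𝒜 : Finset (Finset I)} {ℬ : Finset (Finset J)}

namespace IsSystem

theorem card_suppt_lt (h : IsSystem N β l 𝒜 ℬ) (hN : ∀ i j, |N i j| ≤ 2) (hl : 1 ≤ l)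
    (hlt : midBinom (2 * l) < density 𝒜 * density ℬ) : 8 * #(suppt β) < 9 * l := by
  obtain ⟨i, hi⟩ : ∃ i, 1 < |β i| := by
    by_contra! hall
    have h1 := density_le_of_sum_eq_of_abs_le_one 𝒜 β l hall h.sum_eq
    exact hlt.not_ge ((mul_le_of_le_one_right (density_nonneg _) (density_le_one ℬ)).trans h1)
  have hB := h.density_right_le_of_one_lt hN hi
  have hA := density_le_of_sum_eq 𝒜 (suppt β) β l (fun _ => mem_suppt.1) h.sum_eq
  by_contra! hge
  refine hlt.not_ge ?_
  rcases le_total #(suppt β) (2 * l) with h2 | h2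
  · refine le_trans ?_ (midBinom_mul_le hl hge h2)
    exact mul_le_mul hA hB (density_nonneg _) (midBinom_pos _).le
  · exact (mul_le_of_le_one_right (density_nonneg _) (density_le_one ℬ)).trans
      (hA.trans (midBinom_antitone h2))

/-- Few columns have a nonzero slope. -/
theorem card_le_of_slope_ne_zero {w : ℝ} {v : J → ℝ} {S : Finset J} (hS : ∀ j ∈ S, v j ≠ 0)
    (hd : 102400 ≤ #(suppt β)) (hm : ∀ i, #(suppt (N i)) ≤ 16 * w)
    (hv : ∀ j, #{i ∈ suppt β | N i j ≠ v j * β i} < 51200) : (#S : ℝ) ≤ 32 * w := by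
  have h1 : #S * (#(suppt β) - 51200) ≤ ∑ j ∈ S, #{i ∈ suppt β | N i j ≠ 0} := by
    rw [← smul_eq_mul]
    refine card_nsmul_le_sum _ _ _ fun j hj => ?_
    have e := card_filter_add_card_filter_not (s := suppt β) (fun i => N i j ≠ 0)
    have : #{i ∈ suppt β | ¬ N i j ≠ 0} ≤ #{i ∈ suppt β | N i j ≠ v j * β i} := by
      refine card_le_card fun i hi => ?_
      obtain ⟨hi, h0⟩ := mem_filter.1 hi
      refine mem_filter.2 ⟨hi, ?_⟩
      rw [not_not.1 h0]
      exact (mul_ne_zero (hS j hj) (mem_suppt.1 hi)).symm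
    have := hv j
    omega
  have h2 : ∑ j ∈ S, #{i ∈ suppt β | N i j ≠ 0} ≤ ∑ i ∈ suppt β, #(suppt (N i)) := by
    have := sum_card_bipartiteAbove_eq_sum_card_bipartiteBelow (s := suppt β) (t := S)
      (fun i j => N i j ≠ 0)
    refine (this.symm.trans_le (sum_le_sum fun i _ => card_le_card fun j hj => ?_))
    exact mem_suppt.2 ((mem_bipartiteAbove _).1 hj).2
  have h3 : ∑ i ∈ suppt β, (#(suppt (N i)) : ℝ) ≤ #(suppt β) • (16 * w) :=
    sum_le_card_nsmul _ _ _ fun i _ => hm i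
  have h4 : (#S : ℝ) * (#(suppt β) / 2) ≤ #(suppt β) * (16 * w) := by
    rw [nsmul_eq_mul] at h3
    refine le_trans ?_ h3
    have h5 : #S * #(suppt β) ≤ 2 * ∑ i ∈ suppt β, #(suppt (N i)) := by
      have : #S * #(suppt β) ≤ #S * (2 * (#(suppt β) - 51200)) :=
        Nat.mul_le_mul_left _ (by omega)
      have e : #S * (2 * (#(suppt β) - 51200)) = 2 * (#S * (#(suppt β) - 51200)) := by ring
      omega
    have h6 : (#S : ℝ) * #(suppt β) ≤ 2 * ∑ i ∈ suppt β, (#(suppt (N i)) : ℝ) := by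
      exact_mod_cast h5
    linarith
  have hd0 : (0 : ℝ) < #(suppt β) := Nat.cast_pos.2 (by omega)
  refine le_of_mul_le_mul_right ?_ hd0
  linarith

theorem density_mul_le (h : IsSystem N β l 𝒜 ℬ) (hN : ∀ i j, |N i j| ≤ 2)
    (hd : 10 ^ 15 ≤ #(suppt β)) (hl : 256 ≤ l) :
    density 𝒜 * density ℬ ≤ midBinom (2 * l) := by
  by_contra! hlt
  have hpos := (midBinom_pos (2 * l)).trans hlt
  have h𝒜 : 𝒜.Nonempty := by
    by_contra! h0
    simp [h0, density] at hpos
  have hℬ : ℬ.Nonempty := by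
    by_contra! h0
    simp [h0, density] at hpos
  have hd9 : (#(suppt β) : ℝ) ≤ 9 / 8 * l := by
    have : 8 * (#(suppt β) : ℝ) < 9 * l := by
      exact_mod_cast h.card_suppt_lt hN (by omega) hlt
    linarith
  have hA1 := h.density_left_sq_le
  norm_num at hd
  have hD : (1000000000000000 : ℝ) ≤ #(suppt β) := by exact_mod_cast hd
  have hdN : 102400 ≤ #(suppt β) := le_trans (by norm_num) hd
  have hL : (256 : ℝ) ≤ l := by exact_mod_cast hl
  set D : ℝ := (#(suppt β) : ℝ) with hDdef
  set L : ℝ := (l : ℝ) with hLdef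
  have hD0 : 0 < D := by linarith
  obtain ⟨w, hwD⟩ : ∃ w : ℝ, w * D = L := ⟨L / D, div_mul_cancel₀ _ hD0.ne'⟩
  have hw : 8 / 9 ≤ w := by
    by_contra! hlt'
    nlinarith
  have hw0 : 0 < w := by linarith
  set a := density 𝒜 ^ 2 with ha
  set b := density ℬ ^ 2 with hb
  have ha0 : 0 ≤ a := sq_nonneg _
  have hb0 : 0 ≤ b := sq_nonneg _
  have hb1 : b ≤ 1 := pow_le_one₀ (density_nonneg _) (density_le_one _)
  have hbig : 1 < 4 * L * (a * b) := by
    have h1 := le_midBinom_two_mul_sq (l := l) (by omega)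
    have h2 := pow_lt_pow_left₀ hlt (midBinom_pos _).le two_ne_zero
    rw [mul_pow] at h2
    have h3 := h1.trans_lt h2
    rw [div_lt_iff₀ (by positivity)] at h3
    linarith
  have hDa : D * a ≤ 1 := by
    rw [le_div_iff₀ (by positivity)] at hA1
    nlinarith
  have hm : ∀ i, (#(suppt (N i)) : ℝ) ≤ 16 * w := by
    intro i
    have h1 := h.density_right_sq_le i
    set m : ℝ := (#(suppt (N i)) : ℝ)
    have hm0 : 0 ≤ m := Nat.cast_nonneg _
    have h2 : (D * a) * (b * (m + 1)) ≤ 1 * 4 := by gcongr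
    have h3 : D * (m + 1) ≤ D * (16 * w) := by
      have : D * (m + 1) * 1 ≤ D * (m + 1) * (4 * L * (a * b)) := by gcongr
      nlinarith
    have := le_of_mul_le_mul_left h3 hD0
    linarith
  have hβ : ∀ i, |β i| ≤ 34 * w := by
    intro i
    have := h.abs_le_of_row hN hℬ i
    have := hm i
    linarith
  have hP := h.card_le_card_large hw0 hwD hL hd9
    (hbig.trans_le (by
      have : a * b ≤ a := mul_le_of_le_one_right ha0 hb1
      gcongr)) fun i => (le_abs_self _).trans (hβ i)
  set P : Finset I := {i | 1.01 + w / 100 ≤ β i} with hPdef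
  have hPβ : ∀ i ∈ P, 1.01 + w / 100 ≤ β i := fun i hi => (mem_filter.1 hi).2
  have hP1 : (2900000000000 : ℝ) ≤ #P := by linarith
  have hP1' : 2900000000000 ≤ #P := by exact_mod_cast hP1
  have hA : 1 < 3200 * D * a := by
    obtain ⟨i, hi⟩ := card_pos.1 (by omega : 0 < #P)
    have h1 := h.abs_le_of_row hN hℬ i
    have h2 := (hPβ i hi).trans (le_abs_self _)
    have h3 := h.density_right_sq_le i
    have h4 : b * w ≤ 800 := by nlinarith
    have h5 : D * a * (b * w) ≤ D * a * 800 := by gcongr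
    rw [← hwD] at hbig
    linarith
  choose v hv using h.exists_slope hA (by omega)
  have hvl : ∀ j, |v j| * L ≤ 400000000 := fun j =>
    h.abs_slope_mul_le hN h𝒜 hw hβ hPβ (by omega) (h.card_zero_lt hA j) (hv j)
  set S : Finset J := {j | v j ≠ 0} with hS
  have hSw : (#S : ℝ) ≤ 32 * w :=
    card_le_of_slope_ne_zero (fun j hj => (mem_filter.1 hj).2) hdN hm hv
  set E : I → Finset J := fun i => {j ∈ S | i ∈ suppt β ∧ N i j ≠ v j * β i} with hE
  set P' := {i ∈ P | (#(E i) : ℝ) ≤ w / 600} with hP'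
  have hPP' : (#{i ∈ P | ¬ (#(E i) : ℝ) ≤ w / 600} : ℝ) ≤ 983040000 := by
    set B := {i ∈ P | ¬ (#(E i) : ℝ) ≤ w / 600}
    have h1 : #B • (w / 600) ≤ ∑ i ∈ B, (#(E i) : ℝ) :=
      card_nsmul_le_sum _ _ _ fun i hi => (not_le.1 (mem_filter.1 hi).2).le
    have h2 : ∑ i ∈ B, #(E i) ≤ #S • 51200 := by
      refine (sum_card_bipartiteAbove_eq_sum_card_bipartiteBelow (s := B) (t := S)
        (fun i j => i ∈ suppt β ∧ N i j ≠ v j * β i)).trans_le ?_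
      refine sum_le_card_nsmul _ _ _ fun j _ => le_trans (card_le_card fun i hi => ?_) (hv j).le
      exact mem_filter.2 ((mem_bipartiteBelow _).1 hi).2
    have h3 : ∑ i ∈ B, (#(E i) : ℝ) ≤ #S * 51200 := by
      rw [smul_eq_mul] at h2; exact_mod_cast h2
    rw [nsmul_eq_mul] at h1
    nlinarith
  have hP'c : 655360000 * 16 < #P' := by
    have := card_filter_add_card_filter_not (s := P) (fun i => (#(E i) : ℝ) ≤ w / 600)
    have h2 : #{i ∈ P | ¬ (#(E i) : ℝ) ≤ w / 600} ≤ 983040000 := by exact_mod_cast hPP'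
    rw [← hP'] at this
    omega
  have hsub : ∀ i ∈ P', 1.01 + w / 100 ≤ β i := fun i hi => hPβ i (mem_filter.1 hi).1
  have hP'0 : ∀ i ∈ P', i ∈ suppt β := by
    intro i hi
    have := hsub i hi
    exact mem_suppt.2 (by intro h0; rw [h0] at this; linarith)
  have hSsum : ∀ i ∈ P', ∑ j ∈ S, |N i j| ≤ w / 200 := by
    intro i hi
    have hi' := (mem_filter.1 hi).2
    calc ∑ j ∈ S, |N i j| ≤ ∑ j ∈ S, ((if j ∈ E i then (2 : ℝ) else 0) + 1 / 20000) := by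
          refine sum_le_sum fun j hj => ?_
          by_cases hjE : j ∈ E i
          · rw [if_pos hjE]; have := hN i j; linarith
          · rw [if_neg hjE, zero_add]
            have e : N i j = v j * β i := by
              by_contra hne
              exact hjE (mem_filter.2 ⟨hj, hP'0 i hi, hne⟩)
            rw [e, abs_mul]
            have h1 := hvl j
            rw [← hwD] at h1
            have h2 : |v j| * |β i| ≤ |v j| * (34 * w) :=
              mul_le_mul_of_nonneg_left (hβ i) (abs_nonneg _)
            refine h2.trans ?_
            have h3 : 0 ≤ |v j| * w := by positivity
            nlinarith
      _ = #(S ∩ E i) * 2 + #S * (1 / 20000) := by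
          rw [sum_add_distrib, ← sum_filter, sum_const, sum_const, filter_mem_eq_inter,
            nsmul_eq_mul, nsmul_eq_mul]
      _ ≤ w / 200 := by
          have : (#(S ∩ E i) : ℝ) ≤ #(E i) := Nat.cast_le.2 (card_le_card inter_subset_right)
          linarith
  have hcol : ∀ j ∉ S, #{i ∈ P' | N i j ≠ 0} ≤ 51200 := by
    intro j hj
    have hvj : v j = 0 := by
      by_contra h0
      exact hj (mem_filter.2 ⟨mem_univ _, h0⟩)
    refine le_trans (card_le_card fun i hi => ?_) (hv j).le
    obtain ⟨hi, h0⟩ := mem_filter.1 hi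
    refine mem_filter.2 ⟨hP'0 i hi, ?_⟩
    rwa [hvj, zero_mul]
  have hs : ∀ i ∈ P', 1 ≤ #(suppt (N i) \ S) ∧ w / 400 ≤ #(suppt (N i) \ S) := by
    intro i hi
    obtain ⟨Y, hY⟩ := hℬ
    have h1 : β i - 1 ≤ ∑ j ∈ Y, N i j := by
      rcases h.row Y hY i with h0 | h0 <;> rw [h0] <;> linarith
    have h2 : ∑ j ∈ Y, N i j = ∑ j ∈ Y \ S, N i j + ∑ j ∈ Y ∩ S, N i j := by
      rw [← sum_union (disjoint_sdiff_inter Y S), sdiff_union_inter]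
    have h3 : ∑ j ∈ Y ∩ S, N i j ≤ w / 200 :=
      ((sum_le_sum fun j _ => le_abs_self _).trans
        (sum_le_sum_of_subset_of_nonneg inter_subset_right fun _ _ _ => abs_nonneg _)).trans
        (hSsum i hi)
    have h4 := (abs_le.1 (abs_sum_le_two_mul_card (Y := Y \ S) (S := suppt (N i) \ S) (hN i)
      fun j hj h0 => mem_sdiff.2 ⟨mem_suppt.2 h0, (mem_sdiff.1 hj).2⟩)).2
    have h5 := hsub i hi
    have h6 : w / 400 + 0.005 ≤ (#(suppt (N i) \ S) : ℝ) := by linarith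
    refine ⟨?_, by linarith⟩
    have : (0 : ℝ) < #(suppt (N i) \ S) := by linarith
    exact_mod_cast this
  obtain ⟨R, -, -, hR⟩ := exists_rows_density_le hw0 hsub hSsum hcol hm hs 16 hP'c
  have hbR : b ≤ ((3 / 4) ^ 16) ^ 2 * (1600 / w) := by
    refine le_trans (pow_le_pow_left₀ (density_nonneg _) (density_mono fun Y hY => ?_) 2) hR
    exact mem_rowSat.2 fun i _ => h.row Y hY i
  rw [← mul_div_assoc, le_div_iff₀ hw0] at hbR
  norm_num at hbR
  have h5 : D * a * (b * w) ≤ 1 * (b * w) := by gcongr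
  rw [← hwD] at hbig
  linarith

end IsSystem
end System

section System
variable {I J : Type*} [Fintype I] [Fintype J]
variable [DecidableEq I] [DecidableEq J]
variable {N : I → J → ℝ} {β : I → ℝ} {l : ℕ} {𝒜 : Finset (Finset I)} {ℬ : Finset (Finset J)}

theorem sum_subtype_ne (X : Finset I) (i₀ : I) (f : I → ℝ) :
    ∑ i ∈ X.subtype (· ≠ i₀), f i = ∑ i ∈ X, f i - if i₀ ∈ X then f i₀ else 0 := by
  rw [sum_subtype_eq_sum_filter, filter_ne']
  split_ifs with h
  · rw [← add_sum_erase X f h]; ring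
  · rw [erase_eq_of_notMem h, sub_zero]

namespace IsSystem

/-- Exchanging the roles of the two families of a system. -/
theorem exists_swap (h : IsSystem N β l 𝒜 ℬ) (hN : ∀ i j, |N i j| ≤ 1) (hl : l ≠ 0) {i₀ : I}
    (h0 : β i₀ ≠ 0) (hmax : ∀ i, |β i| ≤ |β i₀|) :
    ∃ (N' : Option J → {i // i ≠ i₀} → ℝ) (β' : Option J → ℝ) (𝒜' : Finset (Finset (Option J)))
      (ℬ' : Finset (Finset {i // i ≠ i₀})), IsSystem N' β' l 𝒜' ℬ' ∧ (∀ j i, |N' j i| ≤ 2) ∧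
        #𝒜' = #ℬ ∧ #ℬ' = #𝒜 ∧ #(suppt β') = #(suppt (N i₀)) + 1 := by
  have hl' : (l : ℝ) ≠ 0 := Nat.cast_ne_zero.2 hl
  let φ : Finset J → Finset (Option J) := fun Y =>
    if ∑ j ∈ Y, N i₀ j = β i₀ then Y.map Function.Embedding.some else insertNone Y
  let ψ : Finset I → Finset {i // i ≠ i₀} := fun X => X.subtype (· ≠ i₀)
  have hφ : ∀ Y ∈ ℬ, ∀ f : Option J → ℝ,
      ∑ y ∈ φ Y, f y = (β i₀ - ∑ j ∈ Y, N i₀ j) * f none + ∑ j ∈ Y, f (some j) := by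
    intro Y hY f
    by_cases hc : ∑ j ∈ Y, N i₀ j = β i₀
    · simp only [φ, if_pos hc]
      rw [sum_map, hc]
      simp
    · simp only [φ, if_neg hc]
      rw [sum_insertNone, (h.row Y hY i₀).resolve_left hc]
      ring
  have hφinj : Function.Injective φ := by
    intro Y Y' hYY
    have e : ∀ Y, eraseNone (φ Y) = Y := by
      intro Y
      simp only [φ]
      split_ifs
      · exact eraseNone_map_some Y
      · exact eraseNone_insertNone Y
    rw [← e Y, hYY, e]
  have hψinj : Set.InjOn ψ 𝒜 := by
    intro X hX X' hX' hXX
    have hmem : i₀ ∈ X ↔ i₀ ∈ X' := by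
      have e1 := sum_subtype_ne X i₀ β
      have e2 := sum_subtype_ne X' i₀ β
      rw [h.sum_eq X hX] at e1
      rw [h.sum_eq X' hX', ← show ψ X = X'.subtype (· ≠ i₀) from hXX, e1] at e2
      split_ifs at e2 with c1 c2 c2 <;> first | tauto | exact absurd (by linarith) h0
    ext i
    by_cases hi : i = i₀
    · rw [hi, hmem]
    · have := congrArg (fun Z => (⟨i, hi⟩ : {i // i ≠ i₀}) ∈ Z) hXX
      simpa [ψ] using this
  refine ⟨fun y i => y.elim (β i / β i₀) fun j => β i / β i₀ * N i₀ j - N i j,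
    fun y => y.elim (l / β i₀) fun j => l / β i₀ * N i₀ j, ℬ.image φ, 𝒜.image ψ,
    ⟨?_, ?_, ?_⟩, ?_, card_image_of_injective _ hφinj, card_image_of_injOn hψinj, ?_⟩
  · intro X hX
    obtain ⟨Y, hY, rfl⟩ := mem_image.1 hX
    rw [hφ Y hY]
    simp only [Option.elim_none, Option.elim_some]
    rw [← mul_sum]
    field_simp
    ring
  · intro X hX i
    obtain ⟨Y, hY, rfl⟩ := mem_image.1 hX
    rw [hφ Y hY]
    simp only [Option.elim_none, Option.elim_some]
    have e : (β i₀ - ∑ j ∈ Y, N i₀ j) * (β i / β i₀) +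
        ∑ j ∈ Y, (β i / β i₀ * N i₀ j - N i j) = β i - ∑ j ∈ Y, N i j := by
      rw [sum_sub_distrib, ← mul_sum]
      field_simp
      ring
    rw [e]
    rcases h.row Y hY i with h1 | h1
    · left; linarith
    · right; linarith
  · intro Y hY y
    obtain ⟨X, hX, rfl⟩ := mem_image.1 hY
    have eX : ∑ i ∈ X, β i / β i₀ = l / β i₀ := by rw [← sum_div, h.sum_eq X hX]
    have h1 := sum_subtype_ne X i₀ (fun i => β i / β i₀)
    rw [eX, div_self h0] at h1
    rcases y with _ | j
    · simp only [Option.elim_none, ψ]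
      rw [h1]
      split_ifs
      · right; rfl
      · left; ring
    · simp only [Option.elim_some, ψ]
      have h2 := sum_subtype_ne X i₀ (fun i => β i / β i₀ * N i₀ j - N i j)
      rw [div_self h0, one_mul, sub_self, ite_self, sub_zero, sum_sub_distrib (s := X), ← sum_mul,
        eX] at h2
      rw [h2]
      rcases h.col X hX j with h3 | h3 <;> rw [h3]
      · left; ring
      · right; rfl
  · intro y i
    have h1 : |β i / β i₀| ≤ 1 := by
      rw [abs_div]
      exact div_le_one_of_le₀ (hmax i) (abs_nonneg _)
    rcases y with _ | j
    · simp only [Option.elim_none]; linarith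
    · simp only [Option.elim_some]
      have h2 := abs_sub (β i / β i₀ * N i₀ j) (N i j)
      rw [abs_mul] at h2
      have h3 := mul_le_one₀ h1 (abs_nonneg _) (hN i₀ j)
      have := hN i j
      linarith
  · rw [← card_insertNone]
    congr 1
    ext y
    rcases y with _ | j
    · simp [mem_suppt, hl, h0]
    · simp [mem_suppt, hl, h0]

theorem card_mul_le_of_le (h : IsSystem N β l 𝒜 ℬ) (hN : ∀ i j, |N i j| ≤ 2) (hl : 256 ≤ l)
    (hd : 10 ^ 15 ≤ #(suppt β)) :
    (#𝒜 * #ℬ : ℝ) ≤ midBinom (2 * l) * 2 ^ (Fintype.card I + Fintype.card J) := by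
  have := h.density_mul_le hN hd hl
  rwa [density, density, div_mul_div_comm, ← pow_add, div_le_iff₀ (by positivity)] at this

theorem card_mul_le (h : IsSystem N β l 𝒜 ℬ) (hN : ∀ i j, |N i j| ≤ 1) (hl : 10 ^ 31 ≤ l) :
    (#𝒜 * #ℬ : ℝ) ≤ midBinom (2 * l) * 2 ^ (Fintype.card I + Fintype.card J) := by
  have hN2 : ∀ i j, |N i j| ≤ 2 := fun i j => (hN i j).trans one_le_two
  have hl256 : 256 ≤ l := le_trans (by norm_num) hl
  have hpos : 0 ≤ midBinom (2 * l) * 2 ^ (Fintype.card I + Fintype.card J) := by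
    have := midBinom_pos (2 * l); positivity
  rcases 𝒜.eq_empty_or_nonempty with rfl | h𝒜
  · simpa using hpos
  rcases ℬ.eq_empty_or_nonempty with rfl | hℬ
  · simpa using hpos
  by_cases hd : 10 ^ 15 ≤ #(suppt β)
  · exact h.card_mul_le_of_le hN2 hl256 hd
  obtain ⟨X, hX⟩ := h𝒜
  have hI : Nonempty I := by
    by_contra hI
    have := h.sum_eq X hX
    rw [not_nonempty_iff] at hI
    rw [X.eq_empty_of_isEmpty, sum_empty] at this
    have : l = 0 := by exact_mod_cast this.symm
    omega
  obtain ⟨i₀, hmax⟩ := Finite.exists_max fun i => |β i|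
  have hβm := h.abs_le_of_row hN2 hℬ i₀
  have hsum : (l : ℝ) ≤ #(suppt β) * |β i₀| := by
    rw [← h.sum_eq X hX, ← nsmul_eq_mul]
    have e : ∑ i ∈ X, β i = ∑ i ∈ X ∩ suppt β, β i := by
      refine (sum_subset inter_subset_left fun i hi hi' => ?_).symm
      by_contra h0
      exact hi' (mem_inter.2 ⟨hi, mem_suppt.2 h0⟩)
    rw [e]
    refine (sum_le_card_nsmul _ _ _ fun i _ => (le_abs_self _).trans (hmax i)).trans ?_
    exact nsmul_le_nsmul_left (abs_nonneg _) (card_le_card inter_subset_right)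
  have hlR : (10 : ℝ) ^ 31 ≤ l := by exact_mod_cast hl
  have hdR : (#(suppt β) : ℝ) ≤ 10 ^ 15 := by exact_mod_cast (not_le.1 hd).le
  have h1 : (10 : ℝ) ^ 31 ≤ 10 ^ 15 * |β i₀| :=
    hlR.trans (hsum.trans (mul_le_mul_of_nonneg_right hdR (abs_nonneg _)))
  have h2 : (10 : ℝ) ^ 16 ≤ |β i₀| := by norm_num at h1 ⊢; linarith
  have h0 : β i₀ ≠ 0 := by
    intro h0
    rw [h0, abs_zero] at h2
    norm_num at h2
  have h3 : 10 ^ 15 ≤ #(suppt (N i₀)) + 1 := by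
    have : (10 : ℝ) ^ 15 ≤ #(suppt (N i₀)) + 1 := by
      have := h2.trans hβm
      norm_num at this ⊢
      linarith
    exact_mod_cast this
  obtain ⟨N', β', 𝒜', ℬ', h', hN', e1, e2, e3⟩ := h.exists_swap hN (by omega) h0 hmax
  have h4 := h'.card_mul_le_of_le hN' hl256 (e3 ▸ h3)
  rw [e1, e2, mul_comm] at h4
  refine h4.trans_eq ?_
  congr 2
  have hc : 0 < Fintype.card I := Fintype.card_pos
  rw [Fintype.card_option, Fintype.card_subtype_compl, Fintype.card_subtype_eq]
  omega

end IsSystem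
end System

/-- A basis of maximal determinant inside a spanning family has coordinates bounded by `1`. -/
theorem exists_basis_abs_repr_le_one {ι W : Type} [Finite ι] [AddCommGroup W] [Module ℝ W]
    (v : ι → W) (hv : Submodule.span ℝ (Set.range v) = ⊤) :
    ∃ (κ : Type) (_ : Fintype κ) (e : Module.Basis κ ℝ W) (s : κ → ι),
      (∀ k, e k = v (s k)) ∧ ∀ k j, |e.repr (v j) k| ≤ 1 := by
  classical
  obtain ⟨b, hb, hspan, hli⟩ := exists_linearIndependent ℝ (Set.range v)
  have hfin : Finite b := (Set.finite_range v).subset hb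
  have hfin' := Fintype.ofFinite b
  let B : Module.Basis b ℝ W := Module.Basis.mk hli (by
    rw [Subtype.range_coe_subtype, Set.ofPred_mem_eq, hspan, hv])
  choose s₀ hs₀ using fun x : b => hb x.2
  have : Nonempty (b → ι) := ⟨s₀⟩
  obtain ⟨s, hs⟩ := Finite.exists_max fun s : b → ι => |B.det (v ∘ s)|
  have hdet : B.det (v ∘ s) ≠ 0 := by
    intro h0
    have h1 := hs s₀
    have e : v ∘ s₀ = B := by
      funext x
      simp [B, hs₀]
    rw [h0, e, Module.Basis.det_self] at h1
    norm_num at h1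
  obtain ⟨hli', hsp⟩ := (Module.Basis.is_basis_iff_det B).2 (isUnit_iff_ne_zero.2 hdet)
  refine ⟨b, hfin', Module.Basis.mk hli' hsp.ge, s, fun k => by simp, fun k j => ?_⟩
  have h1 := congrArg (fun f => f (v j)) (B.det_smul_mk_coord_eq_det_update hli' hsp.ge k)
  have h2 : B.det (v ∘ s) * (Module.Basis.mk hli' hsp.ge).repr (v j) k =
      B.det (v ∘ Function.update s k j) := by
    rw [Function.comp_update]
    exact h1
  have h3 := hs (Function.update s k j)
  rw [← h2, abs_mul] at h3
  exact le_of_mul_le_mul_left (h3.trans_eq (mul_one _).symm) (abs_pos.2 hdet)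

/-- Every cross-intersecting pair comes from a system with bounded coefficients. -/
theorem exists_isSystem {n l : ℕ} {𝒜 ℬ : Finset (Finset (Fin n))} (hℬ : ℬ.Nonempty)
    (h : ∀ A ∈ 𝒜, ∀ B ∈ ℬ, #(A ∩ B) = l) :
    ∃ (I J : Type) (_ : Fintype I) (_ : Fintype J) (N : I → J → ℝ) (β : I → ℝ)
      (𝒜' : Finset (Finset I)) (ℬ' : Finset (Finset J)), IsSystem N β l 𝒜' ℬ' ∧
        (∀ i j, |N i j| ≤ 1) ∧ #𝒜' = #𝒜 ∧ #ℬ' = #ℬ ∧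
          Fintype.card I + Fintype.card J = n := by
  classical
  let u : Fin n → 𝒜 → ℝ := fun j A => if j ∈ A.1 then 1 else 0
  let W := Submodule.span ℝ (Set.range u)
  let v : Fin n → W := fun j => ⟨u j, Submodule.subset_span ⟨j, rfl⟩⟩
  obtain ⟨κ, _, e, s, hes, hrepr⟩ := exists_basis_abs_repr_le_one v (by
    rw [← Submodule.map_injective_of_injective W.subtype_injective |>.eq_iff,
      Submodule.map_span, Submodule.map_top, Submodule.range_subtype, ← Set.range_comp]
    rfl)
  have hsinj : Function.Injective s := fun k k' hk => e.injective (by rw [hes, hes, hk])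
  obtain ⟨B₀, hB₀⟩ := hℬ
  have hconst : ∀ B ∈ ℬ, ∑ j ∈ B, v j = ∑ j ∈ B₀, v j := by
    have key : ∀ B ∈ ℬ, ∀ A : 𝒜, ((∑ j ∈ B, v j : W) : 𝒜 → ℝ) A = l := by
      intro B hB A
      rw [Submodule.coe_sum, Finset.sum_apply]
      simp only [v, u, sum_boole]
      rw [filter_mem_eq_inter, inter_comm, h A A.2 B hB]
    intro B hB
    ext A
    rw [key B hB, key B₀ hB₀]
  let β : κ → ℝ := fun k => e.repr (∑ j ∈ B₀, v j) k
  let X : Finset (Fin n) → Finset κ := fun A => {k | s k ∈ A}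
  let Y : Finset (Fin n) → Finset {j // j ∉ Set.range s} := fun B => B.subtype _
  have heval : ∀ x : W, ∀ A : 𝒜, (x : 𝒜 → ℝ) A = ∑ k ∈ X A, e.repr x k := by
    intro x A
    conv_lhs => rw [← e.sum_repr x]
    rw [Submodule.coe_sum, Finset.sum_apply, sum_filter]
    refine sum_congr rfl fun k _ => ?_
    simp only [Submodule.coe_smul, hes, v, u, Pi.smul_apply, smul_eq_mul, mul_ite, mul_one,
      mul_zero]
  have hrow : ∀ B ∈ ℬ, ∀ k, ∑ j ∈ Y B, e.repr (v j) k = β k - if s k ∈ B then 1 else 0 := by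
    intro B hB k
    have h1 : β k = ∑ j ∈ B, e.repr (v j) k := by
      simp only [β]
      rw [← hconst B hB, map_sum, Finsupp.finsetSum_apply]
    have h3 : ∑ j ∈ Y B, e.repr (v j) k = ∑ j ∈ B with j ∉ Set.range s, e.repr (v j) k :=
      sum_subtype_eq_sum_filter fun j => e.repr (v j) k
    rw [h1, h3, ← sum_filter_add_sum_filter_not B (· ∉ Set.range s),
      add_sub_assoc, left_eq_add, sub_eq_zero]
    have h2 : {j ∈ B | ¬ j ∉ Set.range s} = (univ.filter (s · ∈ B)).map ⟨s, hsinj⟩ := by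
      ext j
      simp only [mem_filter, not_not, Set.mem_range, mem_map, mem_univ, true_and,
        Function.Embedding.coeFn_mk]
      constructor
      · rintro ⟨hj, k, rfl⟩; exact ⟨k, hj, rfl⟩
      · rintro ⟨k, hk, rfl⟩; exact ⟨hk, k, rfl⟩
    rw [h2, sum_map]
    simp only [Function.Embedding.coeFn_mk, ← hes, e.repr_self, Finsupp.single_apply]
    simp
  have hXinj : Set.InjOn X 𝒜 := by
    intro A hA A' hA' hXX
    ext j
    have h1 := heval (v j) ⟨A, hA⟩
    have h2 := heval (v j) ⟨A', hA'⟩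
    rw [show X (⟨A, hA⟩ : 𝒜) = X (⟨A', hA'⟩ : 𝒜) from hXX, ← h2] at h1
    simp only [v, u] at h1
    split_ifs at h1 <;> first | tauto | norm_num at h1
  have hYinj : Set.InjOn Y ℬ := by
    intro B hB B' hB' hYY
    ext j
    by_cases hj : j ∈ Set.range s
    · obtain ⟨k, rfl⟩ := hj
      have h1 := hrow B hB k
      rw [hYY, hrow B' hB' k] at h1
      split_ifs at h1 <;> first | tauto | (exfalso; linarith)
    · have := congrArg (fun Z => (⟨j, hj⟩ : {j // j ∉ Set.range s}) ∈ Z) hYY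
      simpa [Y] using this
  refine ⟨κ, {j // j ∉ Set.range s}, inferInstance, inferInstance, fun k j => e.repr (v j) k, β,
    𝒜.image X, ℬ.image Y, ⟨?_, ?_, ?_⟩, fun k j => hrepr k j, card_image_of_injOn hXinj,
    card_image_of_injOn hYinj, ?_⟩
  · intro Z hZ
    obtain ⟨A, hA, rfl⟩ := mem_image.1 hZ
    have h1 := heval (∑ j ∈ B₀, v j) ⟨A, hA⟩
    rw [← h1, Submodule.coe_sum, Finset.sum_apply]
    simp only [v, u, sum_boole]
    rw [filter_mem_eq_inter, inter_comm, h A hA B₀ hB₀]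
  · intro Z hZ j
    obtain ⟨A, hA, rfl⟩ := mem_image.1 hZ
    rw [← heval (v j) ⟨A, hA⟩]
    simp only [v, u]
    split_ifs <;> simp
  · intro Z hZ k
    obtain ⟨B, hB, rfl⟩ := mem_image.1 hZ
    rw [hrow B hB k]
    split_ifs <;> simp
  · rw [Fintype.card_subtype_compl, ← Set.card_range_of_injective hsinj, Fintype.card_fin]
    have := Fintype.card_subtype_le (· ∈ Set.range s)
    rw [Fintype.card_fin] at this
    exact Nat.add_sub_of_le this

theorem card_mul_card_le {n l : ℕ} (hl : 10 ^ 31 ≤ l) {𝒜 ℬ : Finset (Finset (Fin n))}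
    (h : ∀ A ∈ 𝒜, ∀ B ∈ ℬ, #(A ∩ B) = l) :
    (#𝒜 * #ℬ : ℝ) ≤ (2 * l).choose l * (2 : ℝ) ^ ((n : ℤ) - 2 * (l : ℤ)) := by
  classical
  rcases ℬ.eq_empty_or_nonempty with rfl | hℬ
  · simp only [card_empty, Nat.cast_zero, mul_zero]
    positivity
  obtain ⟨I, J, _, _, N, β, 𝒜', ℬ', hsys, hN, e1, e2, e3⟩ := exists_isSystem hℬ h
  have h1 := hsys.card_mul_le hN hl
  rw [e1, e2, e3, midBinom, Nat.mul_div_cancel_left l two_pos] at h1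
  refine h1.trans_eq ?_
  rw [zpow_sub₀ two_ne_zero, zpow_natCast, ← Nat.cast_two (R := ℤ), ← Nat.cast_mul, zpow_natCast]
  ring

end CrossIntersecting

/-- There exists a positive integer `ℓ₀` such that for every `ℓ ≥ ℓ₀` and
every `n`, every `ℓ`-cross-intersecting pair `(𝒜, ℬ)` of families of subsets of `[n]`
satisfies `|𝒜|·|ℬ| ≤ binom(2ℓ, ℓ)·2^(n−2ℓ)`. -/
theorem stmt_0 :
    ∃ ℓ₀ : ℕ, 0 < ℓ₀ ∧ ∀ ℓ : ℕ, ℓ₀ ≤ ℓ → ∀ n : ℕ,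
      ∀ 𝒜 ℬ : Finset (Finset (Fin n)),
        (∀ A ∈ 𝒜, ∀ B ∈ ℬ, (A ∩ B).card = ℓ) →
        (𝒜.card * ℬ.card : ℝ) ≤
          (Nat.choose (2 * ℓ) ℓ : ℝ) * (2 : ℝ) ^ ((n : ℤ) - 2 * (ℓ : ℤ)) := by
  exact ⟨10 ^ 31, by positivity, fun _ hl _ _ _ h => CrossIntersecting.card_mul_card_le hl h⟩
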